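/- arXiv:2307.00423 — 5 statements merged into one kernel-verified Lean document; each statement's English description precedes it below -/
import Mathlib

section
/- Let n ≥ 2 and let F ∈ ℚ[t] be a polynomial of degree ≥ 1. Let R_ℚ = ℚ[t_1,…,t_n]/(t_1 t_2 ⋯ t_n − 1) and let R_{F,ℚ} be the localization of R_ℚ at the multiplicative set generated by the image of F(t_1)F(t_2)⋯F(t_n). Then the images in R_{F,ℚ} of the n−1 elements F(t_2) − F(t_1), F(t_3) − F(t_2), …, F(t_n) − F(t_{n−1}) form a regular sequence in R_{F,ℚ}. -/
/-- An exhaustive increasing filtration, starting at `0`, such that division by `p` lowers the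
filtration degree and division by `s` does not raise it. -/
def HasDegreeFiltration (K : Type*) {R : Type*} [Field K] [CommRing R] [Algebra K R] (s p : R) :
    Prop :=
  ∃ V : ℕ → Submodule K R, Monotone V ∧ V 0 = ⊥ ∧ (∀ r, ∃ m, r ∈ V m) ∧
    (∀ m r, s * r ∈ V m → r ∈ V m) ∧ ∀ m r, p * r ∈ V m → r ∈ V (m - 1)

/-- Each element of the list is a non-zero-divisor modulo `I` and the preceding elements. -/
def IsWeaklyRegularMod {A : Type*} [CommRing A] : Ideal A → List A → Prop
  | _, [] => True
  | I, x :: xs => (∀ f, x * f ∈ I → f ∈ I) ∧ IsWeaklyRegularMod (I ⊔ Ideal.span {x}) xs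

namespace IsWeaklyRegularMod

variable {A B : Type*} [CommRing A] [CommRing B]

lemma comap_iff (f : A →+* B) (hf : Function.Surjective f) (I : Ideal B) (xs : List A) :
    IsWeaklyRegularMod (I.comap f) xs ↔ IsWeaklyRegularMod I (xs.map f) := by
  induction xs generalizing I with
  | nil => simp [IsWeaklyRegularMod]
  | cons x xs ih =>
    have h : I.comap f ⊔ Ideal.span {x} = (I ⊔ Ideal.span {f x}).comap f := by
      have h1 : I ⊔ Ideal.span {f x} = (I.comap f ⊔ Ideal.span {x}).map f := by
        rw [Ideal.map_sup, Ideal.map_comap_of_surjective f hf, Ideal.map_span,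
          Set.image_singleton]
      rw [h1, Ideal.comap_map_of_surjective f hf, eq_comm, sup_eq_left]
      exact le_sup_of_le_left (Ideal.comap_mono bot_le)
    simp only [IsWeaklyRegularMod, List.map_cons, h, ih, Ideal.mem_comap, map_mul]
    rw [hf.forall]

lemma of_subsingleton [Subsingleton A] (I : Ideal A) (xs : List A) : IsWeaklyRegularMod I xs := by
  induction xs generalizing I with
  | nil => trivial
  | cons x xs ih => exact ⟨fun f _ => Subsingleton.elim 0 f ▸ I.zero_mem, ih _⟩

lemma map_unit_mul {c : A} (hc : IsUnit c) {I : Ideal A} {xs : List A}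
    (h : IsWeaklyRegularMod I xs) : IsWeaklyRegularMod I (xs.map (c * ·)) := by
  induction xs generalizing I with
  | nil => trivial
  | cons x xs ih =>
    refine ⟨fun f hf => h.1 f ?_, ?_⟩
    · rw [mul_assoc] at hf
      exact (Ideal.unit_mul_mem_iff_mem I hc).1 hf
    · dsimp only
      rw [mul_comm c x, Ideal.span_singleton_mul_right_unit hc]
      exact ih h.2

lemma mem_of_getElem_mul_mem {I : Ideal A} {xs : List A} (h : IsWeaklyRegularMod I xs)
    (i : ℕ) (hi : i < xs.length) (f : A) (hf : xs[i] * f ∈ I ⊔ Ideal.ofList (xs.take i)) :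
    f ∈ I ⊔ Ideal.ofList (xs.take i) := by
  induction xs generalizing I i with
  | nil => simp at hi
  | cons x xs ih =>
    cases i with
    | zero => simpa using h.1 f (by simpa using hf)
    | succ i =>
      simp only [List.take_succ_cons, Ideal.ofList_cons, ← sup_assoc,
        List.getElem_cons_succ] at hf ⊢
      exact ih h.2 i _ hf

lemma isWeaklyRegular {xs : List A} (h : IsWeaklyRegularMod ⊥ xs) :
    RingTheory.Sequence.IsWeaklyRegular A xs := by
  refine ⟨fun i hi => ?_⟩
  rw [isSMulRegular_iff_right_eq_zero_of_smul]
  intro f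
  obtain ⟨f, rfl⟩ := Submodule.Quotient.mk_surjective _ f
  rw [← Submodule.Quotient.mk_smul, Submodule.Quotient.mk_eq_zero,
    Submodule.Quotient.mk_eq_zero]
  have := h.mem_of_getElem_mul_mem i hi f
  simpa using this

end IsWeaklyRegularMod

namespace HasDegreeFiltration

variable {K R : Type*} [Field K] [CommRing R] [Algebra K R]

lemma polynomial {F : Polynomial K} (hF : F.Monic) (hd : 1 ≤ F.natDegree) :
    HasDegreeFiltration K (F - Polynomial.C (F.coeff 0)) Polynomial.X := by
  have hs : (F - Polynomial.C (F.coeff 0)).Monic :=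
    hF.sub_of_left (Polynomial.degree_C_le.trans_lt (Polynomial.natDegree_pos_iff_degree_pos.1 hd))
  refine ⟨Polynomial.degreeLT K, fun _ _ h => Polynomial.degreeLT_mono h, ?_, fun r => ?_,
    fun m r h => ?_, fun m r h => ?_⟩
  · ext r
    simp [Polynomial.mem_degreeLT, Polynomial.degree_eq_bot]
  · refine ⟨r.natDegree + 1, Polynomial.mem_degreeLT.2 ?_⟩
    exact Polynomial.degree_le_natDegree.trans_lt (by exact_mod_cast Nat.lt_succ_self _)
  · rw [Polynomial.mem_degreeLT] at h ⊢
    refine lt_of_le_of_lt ?_ h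
    rw [mul_comm]
    exact Polynomial.degree_le_mul_left r hs.ne_zero
  · rw [Polynomial.mem_degreeLT, Polynomial.degree_lt_iff_coeff_zero] at h ⊢
    intro k hk
    rw [← Polynomial.coeff_X_mul]
    exact h _ (by omega)

lemma _root_.Polynomial.degree_C_lt_degree_map [Nontrivial R] {F : Polynomial K} (hF : F.Monic)
    (hd : 1 ≤ F.natDegree) (s : R) :
    (Polynomial.C s).degree < (F.map (algebraMap K R)).degree := by
  rw [hF.degree_map]
  exact Polynomial.degree_C_le.trans_lt (Polynomial.natDegree_pos_iff_degree_pos.1 hd)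

lemma adjoinRoot [Nontrivial R] {F : Polynomial K} (hF : F.Monic) (hd : 1 ≤ F.natDegree) {s p : R}
    (h : HasDegreeFiltration K (s - algebraMap K R (F.coeff 0)) p) {g : Polynomial R}
    (hg : g = F.map (algebraMap K R) - Polynomial.C s) :
    HasDegreeFiltration K
      (AdjoinRoot.of g s - algebraMap K (AdjoinRoot g) (F.coeff 0))
      (AdjoinRoot.of g p * AdjoinRoot.root g) := by
  obtain ⟨V, hmono, hV0, hex, hs, hp⟩ := h
  have hdeg := Polynomial.degree_C_lt_degree_map (R := R) hF hd s
  have hgm : g.Monic := hg ▸ (hF.map _).sub_of_left hdeg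
  have hgd : g.degree = F.natDegree := by
    rw [hg, Polynomial.degree_sub_eq_left_of_degree_lt hdeg, hF.degree_map,
      Polynomial.degree_eq_natDegree hF.ne_zero]
  set φ := AdjoinRoot.modByMonicHom hgm with hφ
  have hφmk (r : AdjoinRoot g) : AdjoinRoot.mk g (φ r) = r := AdjoinRoot.mk_leftInverse hgm r
  have hφdeg (r : AdjoinRoot g) : (φ r).degree < F.natDegree := by
    rw [← hgd, ← hφmk r, hφ, AdjoinRoot.modByMonicHom_mk]
    exact Polynomial.degree_modByMonic_lt _ hgm
  have hφof (a : R) (r : AdjoinRoot g) (j : ℕ) :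
      (φ (AdjoinRoot.of g a * r)).coeff j = a * (φ r).coeff j := by
    rw [← AdjoinRoot.algebraMap_eq, ← Algebra.smul_def, map_smul, Polynomial.coeff_smul,
      smul_eq_mul]
  obtain ⟨d, hd'⟩ : ∃ d, F.natDegree = d + 1 := ⟨F.natDegree - 1, by omega⟩
  have hφroot (r : AdjoinRoot g) : φ (AdjoinRoot.root g * r) =
      Polynomial.X * φ r - Polynomial.C ((φ r).coeff d) * g := by
    conv_lhs => rw [← hφmk r, ← AdjoinRoot.mk_X, ← map_mul, hφ, AdjoinRoot.modByMonicHom_mk, ← hφ]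
    refine (Polynomial.div_modByMonic_unique (Polynomial.C ((φ r).coeff d)) _ hgm
      ⟨by ring, ?_⟩).2
    rw [hgd, Polynomial.degree_lt_iff_coeff_zero]
    intro k hk
    obtain ⟨k, rfl⟩ : ∃ k', k = k' + 1 := ⟨k - 1, by omega⟩
    have hg1 : g.natDegree = d + 1 := hd' ▸ Polynomial.natDegree_eq_of_degree_eq_some hgd
    rw [Polynomial.coeff_sub, Polynomial.coeff_X_mul, Polynomial.coeff_C_mul]
    rcases (show d ≤ k by omega).eq_or_lt with rfl | hlt
    · rw [← hg1, hgm.coeff_natDegree, mul_one, sub_self]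
    · rw [Polynomial.coeff_eq_zero_of_natDegree_lt (p := g) (by omega),
        Polynomial.coeff_eq_zero_of_degree_lt ((hφdeg r).trans_le (by exact_mod_cast (by omega))),
        mul_zero, sub_zero]
  let W : ℕ → Submodule K (AdjoinRoot g) := fun m => ⨅ j, (V m).comap
    ((Polynomial.lcoeff R j ∘ₗ φ).restrictScalars K)
  have hW (m : ℕ) (r : AdjoinRoot g) : r ∈ W m ↔ ∀ j, (φ r).coeff j ∈ V m := by
    simp [W]
  have hroot (m : ℕ) (r : AdjoinRoot g) (hr : AdjoinRoot.root g * r ∈ W m) : r ∈ W m := by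
    simp only [hW, hφroot, hg] at hr ⊢
    have hlead : (φ r).coeff d ∈ V m := by
      refine hs _ _ ?_
      convert hr 0 using 1
      simp
      ring
    intro j
    have := add_mem (hr (j + 1)) ((V m).smul_mem (F.coeff (j + 1)) hlead)
    convert this using 1
    simp [Algebra.smul_def]
    ring
  refine ⟨W, fun m k hmk r hr => ?_, ?_, fun r => ?_, fun m r hr => ?_, fun m r hr => ?_⟩
  · rw [hW] at hr ⊢
    exact fun j => hmono hmk (hr j)
  · rw [eq_bot_iff]
    intro r hr
    rw [hW, hV0] at hr
    rw [Submodule.mem_bot, ← hφmk r, show φ r = 0 from Polynomial.ext (by simpa using hr), map_zero]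
  · choose m hm using fun j => hex ((φ r).coeff j)
    refine ⟨(Finset.range F.natDegree).sup m, (hW _ _).2 fun j => ?_⟩
    by_cases hj : j < F.natDegree
    · exact hmono (Finset.le_sup (Finset.mem_range.2 hj)) (hm j)
    · rw [Polynomial.coeff_eq_zero_of_degree_lt ((hφdeg r).trans_le (by exact_mod_cast not_lt.1 hj))]
      exact zero_mem _
  · rw [hW] at hr ⊢
    intro j
    refine hs _ _ ?_
    rw [← hφof, map_sub]
    exact hr j
  · refine hroot _ _ ?_
    rw [mul_assoc] at hr
    rw [hW] at hr ⊢
    intro j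
    refine hp _ _ ?_
    rw [← hφof]
    exact hr j

lemma eq_zero_of_monomial_mul_eq {σ : Type*} {s p : R} (h : HasDegreeFiltration K s p)
    (e : σ →₀ ℕ) {f : MvPolynomial σ R} (hf : MvPolynomial.monomial e p * f = f) : f = 0 := by
  obtain ⟨V, hmono, hV0, hex, -, hp⟩ := h
  choose m hm using fun j => hex (f.coeff j)
  have key (k : ℕ) : ∀ j, f.coeff j ∈ V (f.support.sup m - k) := by
    induction k with
    | zero =>
      intro j
      by_cases hj : j ∈ f.support
      · exact hmono (Finset.le_sup hj) (hm j)
      · rw [MvPolynomial.notMem_support_iff.1 hj]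
        exact zero_mem _
    | succ k ih =>
      intro j
      rw [← Nat.sub_sub]
      refine hp _ _ ?_
      rw [← MvPolynomial.coeff_monomial_mul j e, hf]
      exact ih _
  ext j
  simpa [hV0] using key (f.support.sup m) j

end HasDegreeFiltration

namespace MvPolynomial

/-- Polynomials in `n + 1` variables as polynomials in `n` variables over `R[X]`, the variable `X 0`
becoming the coefficient `X`. -/
noncomputable def finSuccEquivRight (R : Type*) [CommRing R] (n : ℕ) :
    MvPolynomial (Fin (n + 1)) R ≃ₐ[R] MvPolynomial (Fin n) (Polynomial R) :=
  (renameEquiv R (_root_.finSuccEquiv n)).trans (optionEquivRight R (Fin n))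

variable {R : Type*} [CommRing R] {n : ℕ}

@[simp]
lemma finSuccEquivRight_C (r : R) : finSuccEquivRight R n (C r) = C (Polynomial.C r) := by
  simp [finSuccEquivRight]

@[simp]
lemma finSuccEquivRight_X_zero : finSuccEquivRight R n (X 0) = C Polynomial.X := by
  simp [finSuccEquivRight]

@[simp]
lemma finSuccEquivRight_X_succ (i : Fin n) : finSuccEquivRight R n (X i.succ) = X i := by
  simp [finSuccEquivRight]

end MvPolynomial

open MvPolynomial

/-- The values `s, F(t₁), …, F(t_n)`. -/
noncomputable def valueTuple {K R : Type*} [Field K] [CommRing R] [Algebra K R] (n : ℕ)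
    (F : Polynomial K) (s : R) : Fin (n + 1) → MvPolynomial (Fin n) R :=
  Fin.cons (C s) fun i => Polynomial.aeval (X i) F

/-- The differences of consecutive values in `s, F(t₁), …, F(t_n)` form a regular sequence
modulo `p t₁ ⋯ t_n - 1`. -/
theorem isWeaklyRegularMod_differences {K : Type*} [Field K] {F : Polynomial K} (hF : F.Monic)
    (hd : 1 ≤ F.natDegree) (n : ℕ) {R : Type*} [CommRing R] [Algebra K R] {s p : R}
    (h : HasDegreeFiltration K (s - algebraMap K R (F.coeff 0)) p) :
    IsWeaklyRegularMod (Ideal.span {C p * ∏ i : Fin n, X i - 1})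
      (List.ofFn fun i : Fin n => valueTuple n F s i.succ - valueTuple n F s i.castSucc) := by
  induction n generalizing R with
  | zero => trivial
  | succ n ih =>
    cases subsingleton_or_nontrivial R
    · exact .of_subsingleton _ _
    set g : Polynomial R := F.map (algebraMap K R) - Polynomial.C s with hg
    have hgm : g.Monic := (hF.map _).sub_of_left (Polynomial.degree_C_lt_degree_map hF hd s)
    have h' := h.adjoinRoot hF hd hg
    let e := finSuccEquivRight R n
    let ψ : MvPolynomial (Fin (n + 1)) R →+* MvPolynomial (Fin n) (AdjoinRoot g) :=
      (map (AdjoinRoot.mk g)).comp e.toRingEquiv.toRingHom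
    have hψ : Function.Surjective ψ :=
      (map_surjective _ AdjoinRoot.mk_surjective).comp e.surjective
    have hψC (r : R) : ψ (C r) = C (AdjoinRoot.of g r) := by simp [ψ, e]
    have hψ0 : ψ (X 0) = C (AdjoinRoot.root g) := by simp [ψ, e]
    have hψX (i : Fin n) : ψ (X i.succ) = X i := by simp [ψ, e]
    have hψaeval (x : MvPolynomial (Fin (n + 1)) R) :
        ψ (Polynomial.aeval x F) = Polynomial.aeval (ψ x) F := by
      rw [Polynomial.aeval_def, Polynomial.hom_eval₂, Polynomial.aeval_def]
      congr 1
      ext1 c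
      exact hψC _
    have hroot : Polynomial.aeval (AdjoinRoot.root g) F = AdjoinRoot.of g s := by
      have h0 := AdjoinRoot.eval₂_root g
      rw [hg, Polynomial.eval₂_sub, Polynomial.eval₂_map, Polynomial.eval₂_C, ← hg,
        sub_eq_zero] at h0
      exact h0
    have hψtuple (i : Fin (n + 1)) : ψ (Polynomial.aeval (X i) F) =
        valueTuple n F (AdjoinRoot.of g s) i := by
      rw [hψaeval]
      refine Fin.cases ?_ (fun i => ?_) i
      · rw [hψ0, ← algebraMap_eq, Polynomial.aeval_algebraMap_apply, hroot]
        rfl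
      · rw [hψX]; simp [valueTuple]
    set x := Polynomial.aeval (X 0 : MvPolynomial (Fin (n + 1)) R) F - C s with hx
    have hex : e x = C g := by
      have := Polynomial.aeval_algHom_apply (e.toAlgHom.restrictScalars K) (X 0) F
      rw [hx, map_sub]
      refine (congrArg (· - e (C s)) this.symm).trans ?_
      change Polynomial.aeval (e (X 0)) F - e (C s) = C g
      rw [finSuccEquivRight_X_zero, finSuccEquivRight_C, ← algebraMap_eq,
        Polynomial.aeval_algebraMap_apply, Polynomial.aeval_X_left_eq_map, ← map_sub]
    have hxreg (f : MvPolynomial (Fin (n + 1)) R) (hf : x * f = 0) : f = 0 := by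
      have hef := congrArg e hf
      rw [map_mul, hex, map_zero] at hef
      refine (map_eq_zero_iff e e.injective).1 (MvPolynomial.ext _ _ fun j => ?_)
      refine hgm.isRegular.left ?_
      simpa using congrArg (coeff j) hef
    have hker : RingHom.ker ψ = Ideal.span {x} := by
      have hmk : RingHom.ker (AdjoinRoot.mk g) = Ideal.span {g} := Ideal.mk_ker
      ext f
      rw [RingHom.mem_ker]
      change map (AdjoinRoot.mk g) (e f) = 0 ↔ _
      rw [← RingHom.mem_ker, ker_map, hmk, Ideal.map_span,
        Set.image_singleton, ← hex, Ideal.mem_span_singleton, Ideal.mem_span_singleton,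
        map_dvd_iff]
    set P : MvPolynomial (Fin (n + 1)) R := C p * ∏ i, X i - 1 with hP
    have hψP : ψ P = C (AdjoinRoot.of g p * AdjoinRoot.root g) * ∏ i, X i - 1 := by
      rw [hP, Fin.prod_univ_succ]
      simp only [map_sub, map_mul, hψC, hψ0, map_prod, hψX, map_one, mul_assoc]
    have hψPreg (f : MvPolynomial (Fin n) (AdjoinRoot g)) (hf : ψ P * f = 0) : f = 0 := by
      refine h'.eq_zero_of_monomial_mul_eq (Finsupp.equivFunOnFinite.symm 1) ?_
      rw [monomial_eq, Finsupp.prod_fintype _ _ (by simp)]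
      rw [hψP] at hf
      simpa [sub_mul, sub_eq_zero] using hf
    rw [List.ofFn_succ]
    have hhead : valueTuple (n + 1) F s (Fin.succ 0) -
        valueTuple (n + 1) F s (Fin.castSucc 0) = x := by
      simp [valueTuple, hx]
    rw [hhead]
    refine ⟨fun f hf => ?_, ?_⟩
    · obtain ⟨q, hq⟩ := Ideal.mem_span_singleton'.1 hf
      have hψx : ψ x = 0 := by
        rw [← RingHom.mem_ker, hker]; exact Ideal.mem_span_singleton_self x
      have hψq : ψ q = 0 := hψPreg _ (by rw [mul_comm, ← map_mul, hq, map_mul, hψx, zero_mul])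
      rw [← RingHom.mem_ker, hker] at hψq
      obtain ⟨c, rfl⟩ := Ideal.mem_span_singleton'.1 hψq
      refine Ideal.mem_span_singleton'.2 ⟨c, ?_⟩
      rw [← sub_eq_zero]
      exact hxreg _ (by linear_combination hq)
    · have hI : Ideal.span {P} ⊔ Ideal.span {x} = (Ideal.span {ψ P}).comap ψ := by
        rw [← hker, ← Set.image_singleton (f := ψ), ← Ideal.map_span, Ideal.comap_map_of_surjective ψ hψ]
        rfl
      rw [hI, IsWeaklyRegularMod.comap_iff ψ hψ, hψP, List.map_ofFn]
      convert ih h' using 3 with i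
      rw [Function.comp_apply, map_sub, Fin.castSucc_succ, ← hψtuple, ← hψtuple]
      rfl

open MvPolynomial in
/-- Let `n ≥ 2` and `F ∈ ℚ[t]` of degree ≥ 1. In the localization `R_{F,ℚ}` of
`R_ℚ = ℚ[t₁,…,t_n]/(t₁⋯t_n − 1)` at the powers of the image of `F(t₁)⋯F(t_n)`,
the images of `F(t₂) − F(t₁), …, F(t_n) − F(t_{n−1})` form a regular sequence. -/
theorem stmt4 (n : ℕ) (hn : 2 ≤ n) (F : Polynomial ℚ) (hF : 1 ≤ F.natDegree)
    (I : Ideal (MvPolynomial (Fin n) ℚ))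
    (hI : I = Ideal.span {(∏ i : Fin n, X i) - 1})
    (u : MvPolynomial (Fin n) ℚ ⧸ I)
    (hu : u = Ideal.Quotient.mk I (∏ i : Fin n, Polynomial.aeval (X i) F)) :
    RingTheory.Sequence.IsWeaklyRegular (Localization (Submonoid.powers u))
      (List.ofFn fun i : Fin (n - 1) =>
        algebraMap (MvPolynomial (Fin n) ℚ ⧸ I) (Localization (Submonoid.powers u))
          (Ideal.Quotient.mk I
            (Polynomial.aeval (X (⟨(i : ℕ) + 1, by have := i.2; omega⟩ : Fin n)) F
              - Polynomial.aeval (X (⟨(i : ℕ), by have := i.2; omega⟩ : Fin n)) F))) := by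
  obtain ⟨m, rfl⟩ : ∃ m, n = m + 1 := ⟨n - 1, by omega⟩
  have hF0 : F ≠ 0 := by rintro rfl; simp at hF
  have hc : F.leadingCoeff ≠ 0 := Polynomial.leadingCoeff_ne_zero.2 hF0
  set G : Polynomial ℚ := F * Polynomial.C F.leadingCoeff⁻¹ with hG
  have hGm : G.Monic := Polynomial.monic_mul_leadingCoeff_inv hF0
  have hGd : 1 ≤ G.natDegree := by
    rwa [hG, Polynomial.natDegree_mul_C (inv_ne_zero hc)]
  have hFG (x : MvPolynomial (Fin (m + 1)) ℚ) :
      Polynomial.aeval x F = C F.leadingCoeff * Polynomial.aeval x G := by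
    rw [hG, map_mul, Polynomial.aeval_C, mul_left_comm, algebraMap_eq, ← C_mul,
      mul_inv_cancel₀ hc, C_1, mul_one]
  let e := (finSuccEquivRight ℚ m).toRingEquiv.toRingHom
  have he : Function.Surjective e := (finSuccEquivRight ℚ m).surjective
  have hI' : I = (Ideal.span {C Polynomial.X * ∏ i : Fin m, X i - 1}).comap e := by
    ext f
    rw [hI, Ideal.mem_comap, Ideal.mem_span_singleton, Ideal.mem_span_singleton,
      ← map_dvd_iff (finSuccEquivRight ℚ m)]
    simp [Fin.prod_univ_succ, e]
  have heval (i : Fin (m + 1)) : e (Polynomial.aeval (X i) G) = valueTuple m G G i := by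
    refine (Polynomial.aeval_algHom_apply (finSuccEquivRight ℚ m).toAlgHom (X i) G).symm.trans ?_
    change Polynomial.aeval (finSuccEquivRight ℚ m (X i)) G = _
    refine Fin.cases ?_ (fun i => ?_) i
    · rw [finSuccEquivRight_X_zero, ← algebraMap_eq, Polynomial.aeval_algebraMap_apply,
        Polynomial.aeval_X_left_apply]
      rfl
    · rw [finSuccEquivRight_X_succ]
      simp [valueTuple]
  have key := isWeaklyRegularMod_differences hGm hGd m
    (HasDegreeFiltration.polynomial hGm hGd)
  have key' : IsWeaklyRegularMod I (List.ofFn fun i : Fin m =>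
      Polynomial.aeval (X i.succ) F - Polynomial.aeval (X i.castSucc) F) := by
    have : IsWeaklyRegularMod I (List.ofFn fun i : Fin m =>
        Polynomial.aeval (X i.succ) G - Polynomial.aeval (X i.castSucc) G) := by
      rw [hI', IsWeaklyRegularMod.comap_iff e he, List.map_ofFn]
      convert key using 3 with i
      simp [heval]
    convert this.map_unit_mul ((IsUnit.mk0 _ hc).map C) using 1
    rw [List.map_ofFn]
    congr 1
    funext i
    simp only [hFG, Function.comp_apply, mul_sub]
  have hbot : I = (⊥ : Ideal (MvPolynomial (Fin (m + 1)) ℚ ⧸ I)).comap (Ideal.Quotient.mk I) := by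
    rw [← RingHom.ker_eq_comap_bot, Ideal.mk_ker]
  rw [hbot, IsWeaklyRegularMod.comap_iff _ Ideal.Quotient.mk_surjective, List.map_ofFn] at key'
  have := (key'.isWeaklyRegular).of_isLocalization (Localization (Submonoid.powers u))
    (Submonoid.powers u)
  rw [List.map_ofFn] at this
  exact this
end

section
/- Let n ≥ 2 and let F(t) = Σ_{k=0}^m a_k t^k ∈ ℚ[t] with m ≥ 1 and a_m ≠ 0. Set s = t_1 t_2 ⋯ t_{n−1} ∈ ℚ[t_1,…,t_{n−1}]. Then the sequence of n−1 elements (F(t_2) − F(t_1), F(t_3) − F(t_2), …, F(t_{n−1}) − F(t_{n−2}), Σ_{k=0}^m a_k s^{m−k} − s^m F(t_{n−1})) is a regular sequence in ℚ[t_1,…,t_{n−1}]. -/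
section

open MvPolynomial

/-- A polynomial whose leading coefficient is a unit is a non-zero-divisor modulo any ideal
extended from the coefficient ring. -/
lemma Polynomial.mem_map_C_of_mul_mem {S : Type*} [CommRing S] (J : Ideal S)
    {p q : Polynomial S} (hp : IsUnit p.leadingCoeff)
    (h : p * q ∈ J.map (Polynomial.C : S →+* Polynomial S)) :
    q ∈ J.map (Polynomial.C : S →+* Polynomial S) := by
  have key (r : Polynomial S) : r ∈ J.map (Polynomial.C : S →+* Polynomial S) ↔
      r.map (Ideal.Quotient.mk J) = 0 := by
    simp [Ideal.mem_map_C_iff, Polynomial.ext_iff, Ideal.Quotient.eq_zero_iff_mem]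
  rw [key] at h ⊢
  rw [Polynomial.map_mul] at h
  cases subsingleton_or_nontrivial (S ⧸ J)
  · exact Subsingleton.elim _ _
  refine (Polynomial.isUnit_leadingCoeff_mul_right_eq_zero_iff ?_).1 h
  rw [Polynomial.leadingCoeff_map_eq_of_isUnit_leadingCoeff _ hp]
  exact hp.map _

/-- If neither `c` nor the elements of `A` involve the variable `v`, then `F(X v) - c` is a
non-zero-divisor modulo the ideal generated by `A`. -/
lemma MvPolynomial.mem_span_of_aeval_X_sub_mul_mem {σ k : Type*} [Field k]
    {F : Polynomial k} (hF : 0 < F.natDegree) {v : σ} {c : MvPolynomial σ k}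
    (hc : c ∈ supported k {v}ᶜ) {A : Set (MvPolynomial σ k)} (hA : A ⊆ supported k {v}ᶜ)
    {x : MvPolynomial σ k} (hx : (Polynomial.aeval (X v) F - c) * x ∈ Ideal.span A) :
    x ∈ Ideal.span A := by
  classical
  let e : MvPolynomial σ k ≃ₐ[k] Polynomial (MvPolynomial {j // j ≠ v} k) :=
    (renameEquiv k (Equiv.optionSubtypeNe v).symm).trans (optionEquivLeft k _)
  have heX : e (X v) = Polynomial.X := by simp [e]
  have he (q : MvPolynomial {j // j ≠ v} k) : e (rename Subtype.val q) = Polynomial.C q := by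
    have : (e : MvPolynomial σ k →ₐ[k] _).comp (rename (Subtype.val : {j // j ≠ v} → σ)) =
        (Polynomial.CAlgHom : _ →ₐ[MvPolynomial {j // j ≠ v} k] _).restrictScalars k := by
      ext j
      simp [e, Equiv.optionSubtypeNe_symm_of_ne j.2]
    exact DFunLike.congr_fun this q
  have hsupp (r : MvPolynomial σ k) (hr : r ∈ supported k {v}ᶜ) :
      ∃ q : MvPolynomial {j // j ≠ v} k, rename Subtype.val q = r := by
    rw [supported_eq_range_rename] at hr
    exact hr
  obtain ⟨c, rfl⟩ := hsupp c hc
  obtain ⟨B, rfl⟩ : ∃ B : Set (MvPolynomial {j // j ≠ v} k), rename Subtype.val '' B = A :=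
    Set.subset_range_iff_exists_image_eq.1 fun r hr => hsupp r (hA hr)
  have hspan : (Ideal.span (rename Subtype.val '' B)).map e =
      (Ideal.span B).map (Polynomial.C : _ →+* Polynomial (MvPolynomial {j // j ≠ v} k)) := by
    rw [Ideal.map_span, Ideal.map_span, Set.image_image]
    simp [he]
  have hmem (r : MvPolynomial σ k) : r ∈ Ideal.span (rename Subtype.val '' B) ↔
      e r ∈ (Ideal.span B).map
        (Polynomial.C : _ →+* Polynomial (MvPolynomial {j // j ≠ v} k)) := by
    rw [← hspan]
    refine ⟨Ideal.mem_map_of_mem e, fun h => ?_⟩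
    obtain ⟨y, hy, hyr⟩ := (Ideal.mem_map_of_equiv e _).1 h
    exact e.injective hyr ▸ hy
  rw [hmem] at hx ⊢
  rw [map_mul] at hx
  refine Polynomial.mem_map_C_of_mul_mem _ ?_ hx
  have hF0 : F.leadingCoeff ≠ 0 := by
    rw [Polynomial.leadingCoeff_ne_zero]
    rintro rfl
    simp at hF
  have heF : e (Polynomial.aeval (X v) F) = F.map (algebraMap k _) := by
    rw [← Polynomial.aeval_algHom_apply, heX, Polynomial.aeval_X_left_eq_map]
  rw [map_sub, he, heF, Polynomial.leadingCoeff_sub_of_degree_lt, Polynomial.leadingCoeff_map]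
  · exact (Ne.isUnit hF0).map _
  · refine Polynomial.degree_C_le.trans_lt ?_
    rw [Polynomial.degree_map]
    exact Polynomial.natDegree_pos_iff_degree_pos.1 hF

/-- If the values of `F` at the `t i` all equal an element transcendental over `k`, then the
product of the `t i` is nonzero and `F` takes a different value at its inverse. -/
lemma Polynomial.aeval_inv_prod_ne {k K ι : Type*} [Field k] [Field K] [Algebra k K] [Fintype ι]
    (F : Polynomial k) (t : ι → K) {u : K} (hu : Transcendental k u)
    (ht : ∀ i, aeval (t i) F = u) : ∏ i, t i ≠ 0 ∧ aeval (∏ i, t i)⁻¹ F ≠ u := by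
  have huR : u ∉ (integralClosure k K).toSubring := fun h =>
    hu (IsIntegral.isAlgebraic h)
  have : IsIntegrallyClosedIn (integralClosure k K).toSubring K :=
    inferInstanceAs (IsIntegrallyClosedIn (integralClosure k K) K)
  obtain ⟨V, hV, huV⟩ := Subring.exists_le_valuationSubring_of_isIntegrallyClosedIn huR
  have hk (a : k) : algebraMap k K a ∈ V := hV ((integralClosure k K).algebraMap_mem a)
  have hFV (y : K) (hy : y ∈ V) : aeval y F ∈ V := by
    rw [aeval_eq_sum_range]
    refine sum_mem fun i _ => ?_
    rw [Algebra.smul_def]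
    exact mul_mem (hk _) (pow_mem hy _)
  have htV (i : ι) : t i ∉ V := fun h => huV (ht i ▸ hFV _ h)
  refine ⟨Finset.prod_ne_zero_iff.2 fun i _ h => htV i (h ▸ zero_mem V), fun h => huV ?_⟩
  rw [← h, ← Finset.prod_inv_distrib]
  exact hFV _ (prod_mem fun i _ => (V.mem_or_inv_mem (t i)).resolve_left (htV i))

/-- The differences `F(X (i + 1)) - F(X i)` with `i < j`. -/
def MvPolynomial.consecutiveDiffs {k : Type*} [Field k] (F : Polynomial k) (N j : ℕ) :
    Set (MvPolynomial (Fin N) k) :=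
  {p | ∃ (i : Fin N) (h : (i : ℕ) + 1 < N), (i : ℕ) < j ∧
    p = Polynomial.aeval (X ⟨i + 1, h⟩) F - Polynomial.aeval (X i) F}

lemma MvPolynomial.aeval_X_mem_supported {σ k : Type*} [Field k] (F : Polynomial k) {s : Set σ}
    {i : σ} (hi : i ∈ s) : Polynomial.aeval (X i) F ∈ supported k s :=
  Algebra.adjoin_le (Set.singleton_subset_iff.2 (X_mem_supported.2 hi))
    (Polynomial.aeval_mem_adjoin_singleton k _)

lemma MvPolynomial.consecutiveDiffs_subset_supported {k : Type*} [Field k] (F : Polynomial k)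
    {N j : ℕ} (h : j + 1 < N) : consecutiveDiffs F N j ⊆ supported k ({⟨j + 1, h⟩}ᶜ : Set (Fin N)) := by
  rintro _ ⟨i, hi, hij, rfl⟩
  refine sub_mem (aeval_X_mem_supported F ?_) (aeval_X_mem_supported F ?_) <;>
    simp [Fin.ext_iff] <;> omega

lemma MvPolynomial.consecutiveDiffs_succ {k : Type*} [Field k] (F : Polynomial k)
    {N j : ℕ} (h : j + 1 < N) : consecutiveDiffs F N (j + 1) =
      insert (Polynomial.aeval (X ⟨j + 1, h⟩) F - Polynomial.aeval (X ⟨j, by omega⟩) F)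
        (consecutiveDiffs F N j) := by
  ext p
  constructor
  · rintro ⟨⟨i, hiN⟩, hi, hij, rfl⟩
    obtain rfl | hlt := Nat.eq_or_lt_of_le (Nat.lt_succ_iff.1 hij)
    · exact Or.inl rfl
    · exact Or.inr ⟨_, hi, hlt, rfl⟩
  · rintro (rfl | ⟨i, hi, hij, rfl⟩)
    · exact ⟨⟨j, by omega⟩, h, Nat.lt_succ_self j, rfl⟩
    · exact ⟨i, hi, hij.trans (Nat.lt_succ_self j), rfl⟩

/-- A nonzero polynomial in the first variable is a non-zero-divisor modulo the differences. -/
lemma MvPolynomial.mem_span_consecutiveDiffs_of_mul_mem {k : Type*} [Field k]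
    {F : Polynomial k} (hF : 0 < F.natDegree) {N : ℕ} (hN : 0 < N) {g : MvPolynomial (Fin N) k}
    (hg : g ≠ 0) (hgs : g ∈ supported k ({⟨0, hN⟩} : Set (Fin N))) {j : ℕ} (hj : j < N)
    {x : MvPolynomial (Fin N) k} (hx : g * x ∈ Ideal.span (consecutiveDiffs F N j)) :
    x ∈ Ideal.span (consecutiveDiffs F N j) := by
  induction j generalizing x with
  | zero =>
    have : consecutiveDiffs F N 0 = ∅ := by
      ext; simp [consecutiveDiffs]
    simpa [this, hg] using hx
  | succ j ih =>
    rw [consecutiveDiffs_succ F hj] at hx ⊢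
    set f : MvPolynomial (Fin N) k :=
      Polynomial.aeval (X ⟨j + 1, hj⟩) F - Polynomial.aeval (X ⟨j, by omega⟩) F
    obtain ⟨y, z, hz, hxy⟩ := Ideal.mem_span_insert.1 hx
    have hy : f * y ∈ Ideal.span (insert g (consecutiveDiffs F N j)) :=
      Ideal.mem_span_insert.2 ⟨x, -z, neg_mem hz, by linear_combination -hxy⟩
    have hy' : y ∈ Ideal.span (insert g (consecutiveDiffs F N j)) := by
      refine mem_span_of_aeval_X_sub_mul_mem hF (aeval_X_mem_supported F ?_)
        (Set.insert_subset ?_ (consecutiveDiffs_subset_supported F hj)) hy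
      · simp [Fin.ext_iff]
      · exact supported_mono (by simp [Fin.ext_iff]) hgs
    obtain ⟨b, w, hw, rfl⟩ := Ideal.mem_span_insert.1 hy'
    have hxb : x - b * f ∈ Ideal.span (consecutiveDiffs F N j) := by
      refine ih (by omega) ?_
      have : g * (x - b * f) = f * w + z := by linear_combination hxy
      rw [this]
      exact add_mem (Ideal.mul_mem_left _ _ hw) hz
    exact Ideal.mem_span_insert.2 ⟨b, _, hxb, by ring⟩

/-- If `g` is a zero-divisor modulo `I`, then `g` lies in a prime ideal containing `I` and
consisting of zero-divisors modulo `I`. -/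
lemma Ideal.exists_isPrime_of_mul_mem {R : Type*} [CommRing R] [IsNoetherianRing R] {I : Ideal R}
    {g x : R} (hgx : g * x ∈ I) (hx : x ∉ I) :
    ∃ p : Ideal R, p.IsPrime ∧ I ≤ p ∧ g ∈ p ∧ ∀ r ∈ p, ∃ y, y ∉ I ∧ r * y ∈ I := by
  have hzero : ⋃ p ∈ associatedPrimes R (R ⧸ I), (p : Set R) = {r | ∃ y, y ∉ I ∧ r * y ∈ I} := by
    rw [biUnion_associatedPrimes_eq_zero_divisors]
    ext r
    refine (Ideal.Quotient.mk_surjective.exists).trans ?_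
    simp [Ideal.Quotient.eq_zero_iff_mem, Algebra.smul_def, ← map_mul]
  obtain ⟨p, hp, hgp⟩ := Set.mem_iUnion₂.1 (hzero.ge ⟨x, hx, hgx⟩)
  refine ⟨p, hp.isPrime, ?_, hgp, fun r hr => hzero.le (Set.mem_biUnion hp hr)⟩
  have := IsAssociatedPrime.annihilator_le hp
  rwa [Submodule.annihilator_top, Ideal.annihilator_quotient] at this

/-- All the `F(X i)` agree modulo the full set of differences. -/
lemma MvPolynomial.aeval_X_sub_aeval_X_zero_mem {k : Type*} [Field k] (F : Polynomial k)
    {N : ℕ} (hN : 0 < N) (i : Fin N) :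
    Polynomial.aeval (X i) F - Polynomial.aeval (X ⟨0, hN⟩) F ∈
      Ideal.span (consecutiveDiffs F N (N - 1)) := by
  obtain ⟨i, hi⟩ := i
  induction i with
  | zero => simp
  | succ i ih =>
    rw [← sub_add_sub_cancel _ (Polynomial.aeval (X ⟨i, by omega⟩) F)]
    exact add_mem (Ideal.subset_span ⟨⟨i, by omega⟩, hi, by simp; omega, rfl⟩) (ih _)

/-- Modulo the full set of differences, the polynomial `s ^ m * (F(s⁻¹) - F(X i))`, with `s` the
product of the variables, is a non-zero-divisor. -/
lemma MvPolynomial.mem_span_consecutiveDiffs_of_last_mul_mem {k : Type*} [Field k]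
    {F : Polynomial k} (hF : 0 < F.natDegree) {N m : ℕ} {a : ℕ → k}
    (hFa : F = ∑ l ∈ Finset.range (m + 1), Polynomial.C (a l) * Polynomial.X ^ l) (i : Fin N)
    {x : MvPolynomial (Fin N) k}
    (hx : ((∑ l ∈ Finset.range (m + 1), C (a l) * (∏ j : Fin N, X j) ^ (m - l))
      - (∏ j : Fin N, X j) ^ m * Polynomial.aeval (X i) F) * x ∈
        Ideal.span (consecutiveDiffs F N (N - 1))) :
    x ∈ Ideal.span (consecutiveDiffs F N (N - 1)) := by
  have hN : 0 < N := i.pos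
  by_contra hxI
  obtain ⟨p, hp, hIp, hgp, hzd⟩ := Ideal.exists_isPrime_of_mul_mem hx hxI
  let K := FractionRing (MvPolynomial (Fin N) k ⧸ p)
  let φ : MvPolynomial (Fin N) k →ₐ[k] K :=
    (IsScalarTower.toAlgHom k (MvPolynomial (Fin N) k ⧸ p) K).comp (Ideal.Quotient.mkₐ k p)
  have hφ (r : MvPolynomial (Fin N) k) : φ r = 0 ↔ r ∈ p := by
    rw [← Ideal.Quotient.eq_zero_iff_mem]
    exact map_eq_zero_iff _ (IsFractionRing.injective (MvPolynomial (Fin N) k ⧸ p) K)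
  have hφF (j : Fin N) : Polynomial.aeval (φ (X j)) F = φ (Polynomial.aeval (X ⟨0, hN⟩) F) := by
    rw [Polynomial.aeval_algHom_apply, ← sub_eq_zero, ← map_sub, hφ]
    exact hIp (aeval_X_sub_aeval_X_zero_mem F hN j)
  have htr : Transcendental k (φ (Polynomial.aeval (X ⟨0, hN⟩) F)) := by
    rw [transcendental_iff]
    intro P hP
    by_contra hP0
    rw [Polynomial.aeval_algHom_apply, hφ, ← Polynomial.aeval_comp] at hP
    obtain ⟨y, hy, hPy⟩ := hzd _ hP
    refine hy (mem_span_consecutiveDiffs_of_mul_mem hF hN ?_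
      (aeval_X_mem_supported (P.comp F) rfl) (by omega) hPy)
    have hX : Transcendental k (X ⟨0, hN⟩ : MvPolynomial (Fin N) k) := transcendental_X _ _
    intro h
    rcases Polynomial.comp_eq_zero_iff.1 (transcendental_iff.1 hX _ h) with h | ⟨-, h⟩
    · exact hP0 h
    · rw [h, Polynomial.natDegree_C] at hF
      exact hF.false
  obtain ⟨hs, hne⟩ := Polynomial.aeval_inv_prod_ne F (fun j => φ (X j)) htr hφF
  set s := ∏ j, φ (X j)
  have hrev : ∑ l ∈ Finset.range (m + 1), algebraMap k K (a l) * s ^ (m - l) =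
      s ^ m * Polynomial.aeval s⁻¹ F := by
    conv_rhs => rw [hFa]
    rw [map_sum, Finset.mul_sum]
    refine Finset.sum_congr rfl fun l hl => ?_
    rw [pow_sub₀ _ hs (Nat.lt_succ_iff.1 (Finset.mem_range.1 hl))]
    simp
    ring
  have hg := (hφ _).2 hgp
  rw [map_sub, map_sum, map_mul, map_pow, map_prod, ← Polynomial.aeval_algHom_apply, hφF] at hg
  simp only [map_mul, map_pow, map_prod, algHom_C] at hg
  rw [hrev, ← mul_sub, mul_eq_zero, sub_eq_zero] at hg
  exact hg.elim (pow_ne_zero _ hs) hne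

end


open MvPolynomial in
/-- Let `n ≥ 2` and `F(t) = Σ_{k=0}^m a_k t^k` with `m ≥ 1`, `a_m ≠ 0`, and set
`s = t₁ ⋯ t_{n−1}`.  Then the sequence
`(F(t₂) − F(t₁), …, F(t_{n−1}) − F(t_{n−2}), Σ_{k=0}^m a_k s^{m−k} − s^m F(t_{n−1}))`
of `n − 1` elements is a regular sequence in `ℚ[t₁,…,t_{n−1}]`. -/
theorem stmt5 (n m : ℕ) (hn : 2 ≤ n) (hm : 1 ≤ m) (a : ℕ → ℚ) (F : Polynomial ℚ)
    (hF : F = ∑ k ∈ Finset.range (m + 1), Polynomial.C (a k) * Polynomial.X ^ k)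
    (ham : a m ≠ 0) :
    RingTheory.Sequence.IsWeaklyRegular (MvPolynomial (Fin (n - 1)) ℚ)
      (List.ofFn fun i : Fin (n - 1) =>
        if h : (i : ℕ) + 1 < n - 1 then
          Polynomial.aeval (X (⟨(i : ℕ) + 1, h⟩ : Fin (n - 1))) F
            - Polynomial.aeval (X i) F
        else
          (∑ k ∈ Finset.range (m + 1),
              C (a k) * (∏ j : Fin (n - 1), X j) ^ (m - k))
            - (∏ j : Fin (n - 1), X j) ^ m * Polynomial.aeval (X i) F) := by
  have hFm : F.coeff m = a m := by
    simp [hF, Polynomial.finsetSum_coeff, Polynomial.coeff_X_pow]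
  have hFdeg : 0 < F.natDegree :=
    (Nat.lt_of_lt_of_le Nat.zero_lt_one hm).trans_le
      (Polynomial.le_natDegree_of_ne_zero (hFm ▸ ham))
  clear hFm
  generalize n - 1 = N
  rw [RingTheory.Sequence.isWeaklyRegular_iff]
  intro i hi
  have hiN : i < N := by simpa using hi
  have hspan : Ideal.ofList (List.take i (List.ofFn fun i : Fin N =>
        if h : (i : ℕ) + 1 < N then
          Polynomial.aeval (X (⟨(i : ℕ) + 1, h⟩ : Fin N)) F - Polynomial.aeval (X i) F
        else
          (∑ k ∈ Finset.range (m + 1), C (a k) * (∏ j : Fin N, X j) ^ (m - k))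
            - (∏ j : Fin N, X j) ^ m * Polynomial.aeval (X i) F)) =
      Ideal.span (consecutiveDiffs F N i) := by
    refine congrArg Ideal.span (Set.ext fun p => ?_)
    simp only [Set.mem_ofPred_eq, List.mem_take_iff_getElem, List.getElem_ofFn, List.length_ofFn,
      consecutiveDiffs]
    constructor
    · rintro ⟨j, hj, rfl⟩
      have hj' : j + 1 < N := by omega
      exact ⟨⟨j, by omega⟩, hj', by simp; omega, by simp [hj']⟩
    · rintro ⟨j, hj, hji, rfl⟩
      exact ⟨j, by omega, by simp [hj]⟩
  rw [isSMulRegular_quotient_iff_mem_of_smul_mem, hspan, smul_eq_mul, Ideal.mul_top]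
  intro x hx
  rw [List.getElem_ofFn, smul_eq_mul] at hx
  by_cases h : i + 1 < N
  · rw [dif_pos h] at hx
    refine mem_span_of_aeval_X_sub_mul_mem hFdeg (aeval_X_mem_supported F ?_)
      (consecutiveDiffs_subset_supported F h) hx
    simp [Fin.ext_iff]
  · rw [dif_neg h] at hx
    obtain rfl : i = N - 1 := by omega
    exact mem_span_consecutiveDiffs_of_last_mul_mem hFdeg hF _ hx
end

section
/- Let n ≥ 2, let F(t) = Σ_{i=0}^d μ_i t^i ∈ ℚ[t], and let G ∈ ℚ[t] be a polynomial satisfying t·G′(t) = F(t) − F(0). Then there exists a polynomial Ṽ ∈ ℚ[x_1,…,x_n] such that Ṽ(e_1,…,e_n) = Σ_{k=1}^n G(t_k) in ℚ[t_1,…,t_n], and such that for every j ∈ {0,…,n−2}, the substitution of (e_1,…,e_n) into the formal partial derivative ∂Ṽ/∂x_{n−j−1} equals (−1)^{n−j} · Σ_{i=1}^d μ_i h_{i+j−(n−1)} in ℚ[t_1,…,t_n]. -/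
open MvPolynomial

/-- The complete homogeneous symmetric polynomial of degree `k` in `t₁, …, t_n`:
the sum of all monomials of total degree `k`. -/
noncomputable def completeHomog (n k : ℕ) : MvPolynomial (Fin n) ℚ :=
  ∑ d ∈ Finset.Nat.antidiagonalTuple n k, ∏ i : Fin n, X i ^ d i

/-- `h_k` for an integer `k`, with the convention `h_k = 0` for `k < 0`. -/
noncomputable def hInt (n : ℕ) (k : ℤ) : MvPolynomial (Fin n) ℚ :=
  if k < 0 then 0 else completeHomog n k.toNat

/-- The extension of a derivation of `A` to `A⟦X⟧`, acting on coefficients. -/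
noncomputable def Derivation.mapPowerSeries {R A : Type*} [CommRing R] [CommRing A] [Algebra R A]
    (δ : Derivation R A A) : Derivation R (PowerSeries A) (PowerSeries A) :=
  Derivation.mk'
    { toFun := fun f => PowerSeries.mk fun m => δ (PowerSeries.coeff m f)
      map_add' := fun f g => by ext m; simp
      map_smul' := fun c f => by ext m; simp }
    fun f g => by
      ext m
      simp [PowerSeries.coeff_mul, Finset.sum_add_distrib]
      rw [← Finset.Nat.sum_antidiagonal_swap]
      simp

@[simp]
lemma Derivation.coeff_mapPowerSeries {R A : Type*} [CommRing R] [CommRing A] [Algebra R A]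
    (δ : Derivation R A A) (f : PowerSeries A) (m : ℕ) :
    PowerSeries.coeff m (δ.mapPowerSeries f) = δ (PowerSeries.coeff m f) := by
  simp [Derivation.mapPowerSeries]

lemma Derivation.mapPowerSeries_derivative {R A : Type*} [CommRing R] [CommRing A] [Algebra R A]
    (δ : Derivation R A A) (f : PowerSeries A) :
    δ.mapPowerSeries (PowerSeries.derivative A f)
      = PowerSeries.derivative A (δ.mapPowerSeries f) := by
  ext m
  simp only [Derivation.coeff_mapPowerSeries, PowerSeries.coeff_derivative, Derivation.leibniz,
    map_add, Derivation.map_natCast, Derivation.map_one_eq_zero]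
  simp [mul_comm]

lemma Derivation.eq_neg_sq_mul_of_mul_eq_one {R A : Type*} [CommRing R] [CommRing A] [Algebra R A]
    (δ : Derivation R A A) {a b : A} (h : a * b = 1) : δ b = -(b ^ 2 * δ a) := by
  have h' := congrArg δ h
  simp only [Derivation.leibniz, smul_eq_mul, Derivation.map_one_eq_zero] at h'
  linear_combination b * h' - δ b * h

lemma Derivation.prod_mul_prod_inv {R A ι : Type*} [CommRing R] [CommRing A] [Algebra R A]
    (δ : Derivation R A A) (s : Finset ι) (f q : ι → A) (h : ∀ i, f i * q i = 1) :
    δ (∏ i ∈ s, f i) * ∏ i ∈ s, q i = ∑ i ∈ s, δ (f i) * q i := by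
  classical
  induction s using Finset.induction_on with
  | empty => simp
  | insert a s ha ih =>
    have hs : (∏ i ∈ s, f i) * ∏ i ∈ s, q i = 1 := by
      rw [← Finset.prod_mul_distrib]; simp [h]
    rw [Finset.prod_insert ha, Finset.prod_insert ha, Finset.sum_insert ha, ← ih]
    simp only [Derivation.leibniz, smul_eq_mul]
    linear_combination (δ (∏ i ∈ s, f i) * ∏ i ∈ s, q i) * h a + (δ (f a) * q a) * hs

lemma PowerSeries.one_sub_C_mul_X_mul_mk_pow {A : Type*} [CommRing A] (a : A) :
    (1 - PowerSeries.C a * PowerSeries.X) * PowerSeries.mk (fun m => a ^ m) = 1 := by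
  ext m
  cases m with
  | zero => simp
  | succ m =>
    simp [sub_mul, mul_assoc, PowerSeries.coeff_succ_X_mul, PowerSeries.coeff_one, pow_succ']

/-- The series `1 - x₁ z + x₂ z² - ⋯ + (-1)ⁿ x_n zⁿ`. -/
noncomputable def elemSeries (n : ℕ) : PowerSeries (MvPolynomial (Fin n) ℚ) :=
  1 + ∑ r : Fin n, PowerSeries.C ((-1) ^ ((r : ℕ) + 1) * X r) * PowerSeries.X ^ ((r : ℕ) + 1)

/-- The inverse of `elemSeries n`. -/
noncomputable def homogSeries (n : ℕ) : PowerSeries (MvPolynomial (Fin n) ℚ) :=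
  PowerSeries.invOfUnit (elemSeries n) 1

/-- The power sums of positive degree, as polynomials in the elementary symmetric polynomials:
the series `-z E'(z) / E(z)` with `E = elemSeries n`. -/
noncomputable def psumSeries (n : ℕ) : PowerSeries (MvPolynomial (Fin n) ℚ) :=
  -(PowerSeries.X * (PowerSeries.derivative _ (elemSeries n) * homogSeries n))

lemma elemSeries_mul_homogSeries (n : ℕ) : elemSeries n * homogSeries n = 1 :=
  PowerSeries.mul_invOfUnit _ _ (by simp [elemSeries])

lemma mapPowerSeries_pderiv_elemSeries (n : ℕ) (r : Fin n) :
    (pderiv r).mapPowerSeries (elemSeries n)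
      = PowerSeries.C ((-1) ^ ((r : ℕ) + 1)) * PowerSeries.X ^ ((r : ℕ) + 1) := by
  ext1 m
  have hs (s : Fin n) : pderiv r ((-1 : MvPolynomial (Fin n) ℚ) ^ ((s : ℕ) + 1) * X s)
      = if s = r then (-1) ^ ((s : ℕ) + 1) else 0 := by
    have : (-1 : MvPolynomial (Fin n) ℚ) ^ ((s : ℕ) + 1) = C ((-1) ^ ((s : ℕ) + 1)) := by simp
    rw [this, pderiv_C_mul, pderiv_X, Pi.single_apply]
    simp [eq_comm]
  simp only [Derivation.coeff_mapPowerSeries, elemSeries, map_add, map_sum,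
    PowerSeries.coeff_C_mul, PowerSeries.coeff_X_pow, mul_ite, mul_one,
    mul_zero, apply_ite (pderiv r), hs, map_zero, Derivation.map_one_eq_zero, zero_add]
  rw [Finset.sum_eq_single r]
  · simp
  · intro b _ hb
    simp [hb]
  · simp

lemma mapPowerSeries_pderiv_psumSeries (n : ℕ) (r : Fin n) :
    (pderiv r).mapPowerSeries (psumSeries n)
      = PowerSeries.C ((-1) ^ (r : ℕ)) * (PowerSeries.X *
          PowerSeries.derivative _ (PowerSeries.X ^ ((r : ℕ) + 1) * homogSeries n)) := by
  have hE := elemSeries_mul_homogSeries n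
  have hX :
      (pderiv r).mapPowerSeries (PowerSeries.X : PowerSeries (MvPolynomial (Fin n) ℚ)) = 0 := by
    ext1 m
    simp [PowerSeries.coeff_X, apply_ite (pderiv r)]
  have hC : (PowerSeries.C ((-1) ^ (r : ℕ)) : PowerSeries (MvPolynomial (Fin n) ℚ))
      = (-1) ^ (r : ℕ) := by simp
  have hC' : (PowerSeries.C ((-1) ^ ((r : ℕ) + 1)) : PowerSeries (MvPolynomial (Fin n) ℚ))
      = (-1) ^ ((r : ℕ) + 1) := by simp
  have hd : PowerSeries.derivative (MvPolynomial (Fin n) ℚ)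
      (PowerSeries.C ((-1) ^ ((r : ℕ) + 1)) * PowerSeries.X ^ ((r : ℕ) + 1))
      = PowerSeries.C ((-1) ^ ((r : ℕ) + 1))
        * PowerSeries.derivative _ (PowerSeries.X ^ ((r : ℕ) + 1)) := by
    rw [Derivation.leibniz, PowerSeries.derivative_C]; simp
  rw [psumSeries]
  simp only [map_neg, Derivation.leibniz, smul_eq_mul, hX,
    Derivation.eq_neg_sq_mul_of_mul_eq_one _ hE, Derivation.mapPowerSeries_derivative,
    mapPowerSeries_pderiv_elemSeries, hd]
  rw [hC, hC']
  ring

lemma pderiv_coeff_psumSeries (n : ℕ) (r : Fin n) (m : ℕ) :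
    pderiv r (PowerSeries.coeff m (psumSeries n))
      = (-1) ^ (r : ℕ) * (m * if (r : ℕ) + 1 ≤ m then
          PowerSeries.coeff (m - ((r : ℕ) + 1)) (homogSeries n) else 0) := by
  rw [← Derivation.coeff_mapPowerSeries, mapPowerSeries_pderiv_psumSeries, PowerSeries.coeff_C_mul]
  cases m with
  | zero => simp
  | succ m =>
    rw [PowerSeries.coeff_succ_X_mul, PowerSeries.coeff_derivative, PowerSeries.coeff_X_pow_mul']
    push_cast
    ring

/-- Substitution of the elementary symmetric polynomials, applied to coefficients. -/
noncomputable abbrev esymmSubst (n : ℕ) :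
    PowerSeries (MvPolynomial (Fin n) ℚ) →+* PowerSeries (MvPolynomial (Fin n) ℚ) :=
  PowerSeries.map (aeval (fun r : Fin n => esymm (Fin n) ℚ ((r : ℕ) + 1))).toRingHom

lemma esymmSubst_elemSeries (n : ℕ) :
    esymmSubst n (elemSeries n) = ∏ k : Fin n, (1 - PowerSeries.C (X k) * PowerSeries.X) := by
  have h : ∀ j, ∑ t ∈ Finset.powersetCard j (Finset.univ : Finset (Fin n)),
      ∏ k ∈ t, (-(PowerSeries.C (X k) * PowerSeries.X) : PowerSeries (MvPolynomial (Fin n) ℚ))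
      = PowerSeries.C ((-1) ^ j * esymm (Fin n) ℚ j) * PowerSeries.X ^ j := by
    intro j
    rw [esymm, Finset.mul_sum, map_sum, Finset.sum_mul]
    refine Finset.sum_congr rfl fun t ht => ?_
    rw [Finset.prod_neg, Finset.prod_mul_distrib, Finset.prod_const,
      (Finset.mem_powersetCard.1 ht).2]
    simp [mul_assoc]
  simp_rw [sub_eq_add_neg]
  rw [Finset.prod_one_add, Finset.sum_powerset, Finset.card_univ, Fintype.card_fin,
    Finset.sum_range_succ', Finset.sum_congr rfl fun j _ => h (j + 1), h 0,
    ← Fin.sum_univ_eq_sum_range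
      (fun j => PowerSeries.C ((-1) ^ (j + 1) * esymm (Fin n) ℚ (j + 1)) * PowerSeries.X ^ (j + 1))]
  simp [elemSeries, add_comm]

lemma prod_mk_pow_eq_mk_completeHomog (n : ℕ) :
    ∏ k : Fin n, PowerSeries.mk (fun m => (X k : MvPolynomial (Fin n) ℚ) ^ m)
      = PowerSeries.mk (completeHomog n) := by
  ext1 m
  rw [PowerSeries.coeff_prod, PowerSeries.coeff_mk, completeHomog]
  refine Finset.sum_bij' (fun l _ => ⇑l) (fun l _ => Finsupp.equivFunOnFinite.symm l)
    ?_ ?_ ?_ ?_ ?_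
  · intro l hl
    simpa [Finset.Nat.mem_antidiagonalTuple, Finset.mem_finsuppAntidiag] using hl
  · intro l hl
    simpa [Finset.Nat.mem_antidiagonalTuple, Finset.mem_finsuppAntidiag] using hl
  · intro l _
    ext; simp
  · intro l _
    ext; simp
  · intro l _
    simp

lemma esymmSubst_homogSeries (n : ℕ) :
    esymmSubst n (homogSeries n) = PowerSeries.mk (completeHomog n) := by
  have h₁ : esymmSubst n (elemSeries n) * esymmSubst n (homogSeries n) = 1 := by
    rw [← map_mul, elemSeries_mul_homogSeries, map_one]
  have h₂ : esymmSubst n (elemSeries n) * PowerSeries.mk (completeHomog n) = 1 := by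
    rw [esymmSubst_elemSeries, ← prod_mk_pow_eq_mk_completeHomog, ← Finset.prod_mul_distrib]
    simp [PowerSeries.one_sub_C_mul_X_mul_mk_pow]
  exact (IsUnit.of_mul_eq_one _ h₁).mul_left_cancel (h₁.trans h₂.symm)

lemma esymmSubst_psumSeries (n : ℕ) :
    esymmSubst n (psumSeries n)
      = ∑ k : Fin n, PowerSeries.X * (PowerSeries.C (X k) * PowerSeries.mk (fun m => X k ^ m)) := by
  have hd : esymmSubst n (PowerSeries.derivative _ (elemSeries n))
      = PowerSeries.derivative _ (esymmSubst n (elemSeries n)) := by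
    ext1 m
    simp [PowerSeries.coeff_derivative]
  rw [psumSeries, map_neg, map_mul, map_mul, hd, esymmSubst_homogSeries, esymmSubst_elemSeries,
    ← prod_mk_pow_eq_mk_completeHomog, Derivation.prod_mul_prod_inv _ _ _ _
      fun k => PowerSeries.one_sub_C_mul_X_mul_mk_pow (X k), PowerSeries.map_X, Finset.mul_sum,
    ← Finset.sum_neg_distrib]
  refine Finset.sum_congr rfl fun k _ => ?_
  simp [Derivation.leibniz]

lemma aeval_coeff_psumSeries (n m : ℕ) :
    aeval (fun r : Fin n => esymm (Fin n) ℚ ((r : ℕ) + 1))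
        (PowerSeries.coeff (m + 1) (psumSeries n)) = ∑ k : Fin n, X k ^ (m + 1) := by
  have h := congrArg (PowerSeries.coeff (m + 1)) (esymmSubst_psumSeries n)
  simpa [PowerSeries.coeff_succ_X_mul, pow_succ'] using h

lemma aeval_coeff_homogSeries (n m : ℕ) :
    aeval (fun r : Fin n => esymm (Fin n) ℚ ((r : ℕ) + 1))
        (PowerSeries.coeff m (homogSeries n)) = completeHomog n m := by
  have h := congrArg (PowerSeries.coeff m) (esymmSubst_homogSeries n)
  simpa using h

/-- Let `n ≥ 2`, `F(t) = Σ_{i=0}^d μ_i t^i ∈ ℚ[t]`, and let `G ∈ ℚ[t]` satisfy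
`t·G′(t) = F(t) − F(0)`.  Then there is a polynomial `Ṽ ∈ ℚ[x₁,…,x_n]` with
`Ṽ(e₁,…,e_n) = Σ_{k=1}^n G(t_k)` and such that for all `j ∈ {0,…,n−2}`,
substituting `(e₁,…,e_n)` into `∂Ṽ/∂x_{n−j−1}` gives
`(−1)^{n−j} · Σ_{i=1}^d μ_i h_{i+j−(n−1)}`. -/
theorem stmt8 (n : ℕ) (hn : 2 ≤ n) (d : ℕ) (μ : ℕ → ℚ) (F G : Polynomial ℚ)
    (hF : F = ∑ i ∈ Finset.range (d + 1), Polynomial.C (μ i) * Polynomial.X ^ i)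
    (hG : Polynomial.X * Polynomial.derivative G = F - Polynomial.C (Polynomial.eval 0 F)) :
    ∃ V : MvPolynomial (Fin n) ℚ,
      aeval (fun r : Fin n => esymm (Fin n) ℚ ((r : ℕ) + 1)) V
          = ∑ k : Fin n, Polynomial.aeval (X k) G
      ∧ ∀ j : ℕ, j ≤ n - 2 →
          aeval (fun r : Fin n => esymm (Fin n) ℚ ((r : ℕ) + 1))
              (pderiv (⟨n - j - 2, by omega⟩ : Fin n) V)
            = (-1 : MvPolynomial (Fin n) ℚ) ^ (n - j) *
                ∑ i ∈ Finset.Icc 1 d,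
                  C (μ i) * hInt n ((i : ℤ) + (j : ℤ) - ((n : ℤ) - 1)) := by
  have hcoeff (m : ℕ) : G.coeff (m + 1) * (m + 1) = if m + 1 ≤ d then μ (m + 1) else 0 := by
    have h := congrArg (fun p => Polynomial.coeff p (m + 1)) hG
    simpa [hF, Polynomial.coeff_X_mul, Polynomial.coeff_derivative, Polynomial.coeff_C,
      Polynomial.coeff_X_pow, Polynomial.finsetSum_coeff, Nat.lt_succ_iff] using h
  obtain ⟨N, hGN, hdN⟩ : ∃ N, G.natDegree < N + 1 ∧ d ≤ N :=
    ⟨max G.natDegree d, by omega, by omega⟩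
  refine ⟨C (n * G.coeff 0) + ∑ m ∈ Finset.range N,
    C (G.coeff (m + 1)) * PowerSeries.coeff (m + 1) (psumSeries n), ?_, fun j hj => ?_⟩
  · simp only [Polynomial.aeval_eq_sum_range' hGN, Finset.sum_range_succ', map_add, map_sum,
      map_mul, aeval_coeff_psumSeries, Finset.sum_add_distrib]
    rw [Finset.sum_comm, add_comm]
    simp [Algebra.smul_def, Finset.mul_sum, algebraMap_eq]
  · have hsum : ∑ i ∈ Finset.Icc 1 d, C (μ i) * hInt n ((i : ℤ) + (j : ℤ) - ((n : ℤ) - 1))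
        = ∑ m ∈ Finset.range N, C (G.coeff (m + 1) * (m + 1)) *
            hInt n (((m + 1 : ℕ) : ℤ) + (j : ℤ) - ((n : ℤ) - 1)) := by
      have hIcc : Finset.Icc 1 d = (Finset.range d).map (addRightEmbedding 1) := by
        rw [Finset.range_eq_Ico, Finset.map_add_right_Ico]
        rfl
      rw [hIcc, Finset.sum_map]
      simp only [addRightEmbedding_apply]
      rw [← Finset.sum_subset (Finset.range_subset_range.2 hdN)]
      · refine Finset.sum_congr rfl fun m hm => ?_
        rw [hcoeff, if_pos (Nat.succ_le_of_lt (Finset.mem_range.1 hm))]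
      · intro m _ hm
        rw [hcoeff, if_neg (by simpa [Nat.succ_le_iff] using hm), C_0, zero_mul]
    have hh (m : ℕ) : hInt n (((m + 1 : ℕ) : ℤ) + (j : ℤ) - ((n : ℤ) - 1))
        = if n - j - 2 + 1 ≤ m + 1 then completeHomog n (m + 1 - (n - j - 2 + 1)) else 0 := by
      rw [hInt]
      split_ifs with h₁ h₂ h₂
      · omega
      · rfl
      · congr 1
        omega
      · omega
    have hsign : (-1 : MvPolynomial (Fin n) ℚ) ^ (n - j) = (-1) ^ (n - j - 2) := by
      obtain ⟨k, hk⟩ : ∃ k, n - j = k + 2 := ⟨n - j - 2, by omega⟩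
      simp [hk, pow_add]
    rw [hsum, hsign]
    simp only [map_add, map_sum, pderiv_C, pderiv_C_mul, zero_add, pderiv_coeff_psumSeries,
      Finset.mul_sum, hh]
    refine Finset.sum_congr rfl fun m _ => ?_
    simp only [map_mul, map_pow, map_neg, map_one, map_natCast, apply_ite (aeval _),
      aeval_coeff_homogSeries, map_zero, aeval_C, algebraMap_eq, map_add]
    push_cast
    ring
end

section
/- Let n ≥ 2 and let F ∈ ℚ[t] be a polynomial of degree ≥ 1. In P = ℚ[t_1,…,t_n], let J be the ideal generated by the n−1 elements F(t_2) − F(t_1), F(t_3) − F(t_2), …, F(t_n) − F(t_{n−1}). Then the set of antisymmetric elements of J equals the submodule of P over the subring P^{S_n} of symmetric polynomials generated by q_0, q_1, …, q_{n−2}. -/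
open MvPolynomial

/-- `q_i`: the determinant of the `n × n` matrix whose first row is
`(F(t₁)t₁^i, …, F(t_n)t_n^i)` and whose `r`-th row (`1 ≤ r ≤ n−1`, 0-based) is
`(t₁^{n−1−r}, …, t_n^{n−1−r})`. -/
noncomputable def qdet (n : ℕ) (F : Polynomial ℚ) (i : ℕ) : MvPolynomial (Fin n) ℚ :=
  (Matrix.of fun r c : Fin n =>
    if (r : ℕ) = 0 then Polynomial.aeval (X c) F * X c ^ i
    else X c ^ (n - 1 - (r : ℕ))).det

section Divisibility

variable {ι : Type*}

lemma irreducible_X_sub_X {i j : ι} (h : i ≠ j) :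
    Irreducible (X i - X j : MvPolynomial ι ℚ) := by
  have := irreducible_mul_X_add (1 : MvPolynomial ι ℚ) (-X j) i one_ne_zero (by simp)
    (by simpa [vars_neg] using h) isRelPrime_one_left
  simpa [sub_eq_add_neg] using this

lemma isRelPrime_X_sub_X {i j k l : ι} (hij : i ≠ j) (hkl : k ≠ l)
    (h : s(i, j) ≠ s(k, l)) :
    IsRelPrime (X i - X j : MvPolynomial ι ℚ) (X k - X l) := by
  classical
  rw [(irreducible_X_sub_X hij).isRelPrime_iff_not_dvd]
  intro hdvd
  have h1 := map_dvd (rename (R := ℚ) fun x => if x = j then i else x) hdvd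
  simp only [map_sub, rename_X, if_neg hij, if_true, sub_self, zero_dvd_iff, sub_eq_zero,
    (X_injective (σ := ι) (R := ℚ)).eq_iff] at h1
  apply h
  rw [Sym2.eq_iff]
  grind

lemma X_sub_X_dvd_sub_rename_swap [DecidableEq ι] (i j : ι) (p : MvPolynomial ι ℚ) :
    X i - X j ∣ p - rename (Equiv.swap i j) p := by
  rw [← Ideal.mem_span_singleton, ← Ideal.Quotient.mk_eq_mk_iff_sub_mem]
  set I := Ideal.span {(X i - X j : MvPolynomial ι ℚ)}
  have hI : Ideal.Quotient.mk I (X i) = Ideal.Quotient.mk I (X j) :=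
    Ideal.Quotient.mk_eq_mk_iff_sub_mem _ _ |>.2 (Ideal.mem_span_singleton_self _)
  have : Ideal.Quotient.mkₐ ℚ I = (Ideal.Quotient.mkₐ ℚ I).comp (rename (Equiv.swap i j)) := by
    ext k
    simp only [Ideal.Quotient.mkₐ_eq_mk, AlgHom.comp_apply, rename_X]
    by_cases h1 : k = i
    · simp [h1, hI]
    · by_cases h2 : k = j
      · simp [h2, hI]
      · rw [Equiv.swap_apply_of_ne_of_ne h1 h2]
  exact DFunLike.congr_fun this p

lemma X_sub_X_dvd_of_rename_swap_eq_neg [DecidableEq ι] {i j : ι} {p : MvPolynomial ι ℚ}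
    (h : rename (Equiv.swap i j) p = -p) : X i - X j ∣ p := by
  have h1 := X_sub_X_dvd_sub_rename_swap i j p
  rw [h, sub_neg_eq_add, ← two_mul] at h1
  have h2 : (2 : MvPolynomial ι ℚ) = C 2 := (map_ofNat C 2).symm
  rw [h2] at h1
  exact ((isUnit_iff_ne_zero.2 (two_ne_zero (α := ℚ))).map C).dvd_mul_left.1 h1

lemma det_vandermonde_X_dvd [DecidableEq ι] {k : ℕ} {e : Fin k → ι} (he : Function.Injective e)
    {p : MvPolynomial ι ℚ}
    (hp : ∀ i j, i ≠ j → rename (Equiv.swap (e i) (e j)) p = -p) :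
    (Matrix.vandermonde fun i => (X (e i) : MvPolynomial ι ℚ)).det ∣ p := by
  rw [Matrix.det_vandermonde, Finset.prod_sigma']
  refine Finset.prod_dvd_of_isRelPrime ?_ ?_
  · rintro ⟨i, j⟩ hij ⟨k, l⟩ hkl hne
    simp only [Finset.coe_sigma, Set.mem_sigma_iff, Finset.mem_coe, Finset.mem_univ,
      Finset.mem_Ioi, true_and] at hij hkl
    refine isRelPrime_X_sub_X (he.ne hij.ne') (he.ne hkl.ne') ?_
    simp only [ne_eq, Sym2.eq_iff, he.eq_iff]
    rintro (⟨rfl, rfl⟩ | ⟨rfl, rfl⟩)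
    · exact hne rfl
    · exact lt_asymm hij hkl
  · rintro ⟨i, j⟩ hij
    simp only [Finset.mem_sigma, Finset.mem_univ, Finset.mem_Ioi, true_and] at hij
    exact X_sub_X_dvd_of_rename_swap_eq_neg (hp j i hij.ne')

lemma det_vandermonde_X_ne_zero {k : ℕ} {e : Fin k → ι} (he : Function.Injective e) :
    (Matrix.vandermonde fun i => (X (e i) : MvPolynomial ι ℚ)).det ≠ 0 :=
  Matrix.det_vandermonde_ne_zero_iff.2 (X_injective.comp he)

end Divisibility

section Antisymmetry

variable {n : ℕ}

lemma rename_det_of_rename_apply {M N : Matrix (Fin n) (Fin n) (MvPolynomial (Fin n) ℚ)}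
    {σ : Equiv.Perm (Fin n)} (h : ∀ r c, rename σ (M r c) = N r (σ c)) :
    rename σ M.det = (Equiv.Perm.sign σ : ℤ) • N.det := by
  rw [zsmul_eq_mul, ← Matrix.det_permute', AlgHom.map_det]
  congr 1
  ext1 r c
  exact h r c

lemma rename_det_vandermonde_X (σ : Equiv.Perm (Fin n)) :
    rename σ (Matrix.vandermonde fun i => (X i : MvPolynomial (Fin n) ℚ)).det
      = (Equiv.Perm.sign σ : ℤ) • (Matrix.vandermonde fun i => X i).det := by
  rw [← Matrix.det_transpose]
  exact rename_det_of_rename_apply fun r c => by simp [Matrix.vandermonde_apply]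

/-- An equivariant family of polynomials is interpolated by a polynomial of degree `< n` with
symmetric coefficients. -/
lemma exists_isSymmetric_eq_sum_mul_X_pow {g : Fin n → MvPolynomial (Fin n) ℚ}
    (hg : ∀ (σ : Equiv.Perm (Fin n)) c, rename σ (g c) = g (σ c)) :
    ∃ s : Fin n → MvPolynomial (Fin n) ℚ, (∀ i, (s i).IsSymmetric) ∧
      ∀ c, g c = ∑ i, s i * X c ^ (i : ℕ) := by
  set V := Matrix.vandermonde fun i => (X i : MvPolynomial (Fin n) ℚ) with hV
  have hV0 : V.det ≠ 0 := det_vandermonde_X_ne_zero Function.injective_id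
  have hA : ∀ (σ : Equiv.Perm (Fin n)) i,
      rename σ (V.cramer g i) = (Equiv.Perm.sign σ : ℤ) • V.cramer g i := by
    intro σ i
    rw [Matrix.cramer_apply, ← Matrix.det_transpose]
    refine rename_det_of_rename_apply fun r c => ?_
    by_cases h : r = i
    · subst h; simp [hg]
    · simp [Matrix.updateCol_ne h, hV, Matrix.vandermonde_apply]
  have hdvd : ∀ i, V.det ∣ V.cramer g i := fun i =>
    det_vandermonde_X_dvd Function.injective_id fun a b hab => by
      simp [hA, Equiv.Perm.sign_swap hab]
  choose s hs using hdvd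
  refine ⟨s, fun i σ => ?_, fun c => ?_⟩
  · have h := hA σ i
    rw [hs, map_mul, rename_det_vandermonde_X, ← smul_mul_assoc] at h
    refine mul_left_cancel₀ ?_ h
    rw [zsmul_eq_mul]
    exact mul_ne_zero (by simp) hV0
  · have h := congrFun (Matrix.mulVec_cramer V g) c
    apply mul_left_cancel₀ hV0
    rw [Pi.smul_apply, smul_eq_mul] at h
    rw [← h, Finset.mul_sum]
    simp only [Matrix.mulVec, dotProduct]
    refine Finset.sum_congr rfl fun i _ => ?_
    rw [hs, hV, Matrix.vandermonde_apply]
    ring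

end Antisymmetry

section Cofactors

variable {m : ℕ}

/-- The matrix with first row `f` whose other rows are `X c ^ (m - r)`. -/
noncomputable def firstRowMatrix (f : Fin (m + 1) → MvPolynomial (Fin (m + 1)) ℚ) :
    Matrix (Fin (m + 1)) (Fin (m + 1)) (MvPolynomial (Fin (m + 1)) ℚ) :=
  Matrix.of fun r c => if (r : ℕ) = 0 then f c else X c ^ (m - (r : ℕ))

/-- The cofactors of `firstRowMatrix` along the first row. -/
noncomputable def firstRowCofactor (c : Fin (m + 1)) : MvPolynomial (Fin (m + 1)) ℚ :=
  (firstRowMatrix (Pi.single c 1)).det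

lemma submatrix_firstRowMatrix (f : Fin (m + 1) → MvPolynomial (Fin (m + 1)) ℚ)
    (e : Fin m → Fin (m + 1)) :
    (firstRowMatrix f).submatrix Fin.succ e
      = Matrix.of fun r c : Fin m => X (e c) ^ (m - ((r : ℕ) + 1)) := by
  ext1 r c
  simp [firstRowMatrix]

lemma firstRowCofactor_eq (c : Fin (m + 1)) :
    firstRowCofactor c = (-1) ^ (c : ℕ) *
      (Matrix.of fun r d : Fin m =>
        (X (c.succAbove d) : MvPolynomial (Fin (m + 1)) ℚ) ^ (m - ((r : ℕ) + 1))).det := by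
  rw [firstRowCofactor, Matrix.det_succ_row_zero, Finset.sum_eq_single c]
  · rw [submatrix_firstRowMatrix]; simp [firstRowMatrix]
  · intro b _ hb; simp [firstRowMatrix, hb]
  · simp

lemma det_firstRowMatrix (f : Fin (m + 1) → MvPolynomial (Fin (m + 1)) ℚ) :
    (firstRowMatrix f).det = ∑ c, f c * firstRowCofactor c := by
  rw [Matrix.det_succ_row_zero]
  refine Finset.sum_congr rfl fun c _ => ?_
  rw [submatrix_firstRowMatrix, firstRowCofactor_eq]
  simp only [firstRowMatrix, Matrix.of_apply, Fin.val_zero, if_true]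
  ring

lemma rename_firstRowCofactor (σ : Equiv.Perm (Fin (m + 1))) (c : Fin (m + 1)) :
    rename σ (firstRowCofactor c) = (Equiv.Perm.sign σ : ℤ) • firstRowCofactor (σ c) := by
  refine rename_det_of_rename_apply fun r d => ?_
  by_cases hr : r = 0 <;> by_cases hd : d = c <;>
    simp [firstRowMatrix, hr, hd]

lemma det_X_pow_rev {ι : Type*} {k : ℕ} (e : Fin k → ι) :
    (Matrix.of fun r c : Fin k => (X (e c) : MvPolynomial ι ℚ) ^ (k - ((r : ℕ) + 1))).det
      = (Equiv.Perm.sign (Fin.revPerm (n := k)) : ℤ) •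
        (Matrix.vandermonde fun i => (X (e i) : MvPolynomial ι ℚ)).det := by
  rw [zsmul_eq_mul, ← Matrix.det_transpose (Matrix.vandermonde _), ← Matrix.det_permute]
  congr 1

lemma units_zsmul_dvd_iff {R : Type*} [CommRing R] (u : ℤˣ) {a b : R} :
    (u : ℤ) • a ∣ b ↔ a ∣ b := by
  rcases Int.units_eq_one_or u with rfl | rfl <;> simp

lemma units_zsmul_ne_zero {R : Type*} [CommRing R] (u : ℤˣ) {a : R} (ha : a ≠ 0) :
    (u : ℤ) • a ≠ 0 := by
  rcases Int.units_eq_one_or u with rfl | rfl <;> simpa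

lemma firstRowCofactor_zero : (firstRowCofactor 0 : MvPolynomial (Fin (m + 1)) ℚ)
    = (Equiv.Perm.sign (Fin.revPerm (n := m)) : ℤ) •
      (Matrix.vandermonde fun i : Fin m => X i.succ).det := by
  rw [firstRowCofactor_eq, ← det_X_pow_rev]
  simp

lemma firstRowCofactor_ne_zero (c : Fin (m + 1)) : firstRowCofactor c ≠ 0 := by
  have h0 : (firstRowCofactor 0 : MvPolynomial (Fin (m + 1)) ℚ) ≠ 0 := by
    rw [firstRowCofactor_zero]
    exact units_zsmul_ne_zero _ (det_vandermonde_X_ne_zero (Fin.succ_injective m))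
  intro hc
  have h := rename_firstRowCofactor (Equiv.swap c 0) c
  rw [hc, Equiv.swap_apply_left, map_zero] at h
  exact units_zsmul_ne_zero _ h0 h.symm

lemma firstRowCofactor_dvd {B : Fin (m + 1) → MvPolynomial (Fin (m + 1)) ℚ}
    (hB : ∀ (σ : Equiv.Perm (Fin (m + 1))) c,
      rename σ (B c) = (Equiv.Perm.sign σ : ℤ) • B (σ c)) (c : Fin (m + 1)) :
    firstRowCofactor c ∣ B c := by
  have h0 : firstRowCofactor 0 ∣ B 0 := by
    rw [firstRowCofactor_zero, units_zsmul_dvd_iff]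
    refine det_vandermonde_X_dvd (Fin.succ_injective m) fun i j hij => ?_
    rw [hB, Equiv.Perm.sign_swap ((Fin.succ_injective m).ne hij),
      Equiv.swap_apply_of_ne_of_ne (Fin.succ_ne_zero i).symm (Fin.succ_ne_zero j).symm]
    simp
  have h := map_dvd (rename (Equiv.swap 0 c)) h0
  rw [hB, rename_firstRowCofactor, units_zsmul_dvd_iff, Equiv.swap_apply_left] at h
  rcases Int.units_eq_one_or (Equiv.Perm.sign (Equiv.swap 0 c)) with h1 | h1 <;>
    simpa [h1] using h

lemma sum_X_pow_mul_firstRowCofactor {i : ℕ} (hi : i < m) :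
    ∑ c : Fin (m + 1), X c ^ i * firstRowCofactor c = 0 := by
  rw [← det_firstRowMatrix]
  have hne : (0 : Fin (m + 1)) ≠ ⟨m - i, by omega⟩ := by
    simp only [ne_eq, Fin.ext_iff, Fin.val_zero]; omega
  refine Matrix.det_zero_of_row_eq hne ?_
  ext1 c
  have h : m - i ≠ 0 := by omega
  have h' : m - (m - i) = i := by omega
  simp [firstRowMatrix, h, h']

lemma sum_X_pow_mul_firstRowCofactor_ne_zero :
    ∑ c : Fin (m + 1), X c ^ m * firstRowCofactor c ≠ 0 := by
  have h := det_X_pow_rev (id : Fin (m + 1) → Fin (m + 1))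
  have h' : (Matrix.of fun r c : Fin (m + 1) =>
      (X (id c) : MvPolynomial (Fin (m + 1)) ℚ) ^ (m + 1 - ((r : ℕ) + 1)))
      = firstRowMatrix fun c => X c ^ m := by
    ext1 r c
    by_cases hr : r = 0 <;> simp [firstRowMatrix, hr]
  rw [h', det_firstRowMatrix] at h
  rw [h]
  exact units_zsmul_ne_zero _ (det_vandermonde_X_ne_zero Function.injective_id)

lemma exists_isSymmetric_eq_sum_mul_firstRowCofactor
    {B : Fin (m + 1) → MvPolynomial (Fin (m + 1)) ℚ}
    (hB : ∀ (σ : Equiv.Perm (Fin (m + 1))) c,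
      rename σ (B c) = (Equiv.Perm.sign σ : ℤ) • B (σ c)) (hsum : ∑ c, B c = 0) :
    ∃ s : Fin m → MvPolynomial (Fin (m + 1)) ℚ, (∀ i, (s i).IsSymmetric) ∧
      ∀ c, B c = ∑ i, s i * (X c ^ (i : ℕ) * firstRowCofactor c) := by
  choose g hg using firstRowCofactor_dvd hB
  have hgσ : ∀ (σ : Equiv.Perm (Fin (m + 1))) c, rename σ (g c) = g (σ c) := by
    intro σ c
    have h := hB σ c
    rw [hg, hg (σ c), map_mul, rename_firstRowCofactor, ← smul_mul_assoc] at h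
    exact mul_left_cancel₀ (units_zsmul_ne_zero _ (firstRowCofactor_ne_zero _)) h
  obtain ⟨s, hs, hgs⟩ := exists_isSymmetric_eq_sum_mul_X_pow hgσ
  have hBs : ∀ c, B c = ∑ i, s i * (X c ^ (i : ℕ) * firstRowCofactor c) := by
    intro c
    rw [hg, hgs, Finset.mul_sum]
    exact Finset.sum_congr rfl fun i _ => by ring
  have hlast : s (Fin.last m) = 0 := by
    simp only [hBs] at hsum
    rw [Finset.sum_comm] at hsum
    simp only [← Finset.mul_sum] at hsum
    rw [Fin.sum_univ_castSucc, Finset.sum_eq_zero, zero_add] at hsum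
    · exact (mul_eq_zero.1 hsum).resolve_right sum_X_pow_mul_firstRowCofactor_ne_zero
    · intro i _
      rw [Fin.val_castSucc, sum_X_pow_mul_firstRowCofactor i.2, mul_zero]
  refine ⟨fun i => s i.castSucc, fun i => hs _, fun c => ?_⟩
  rw [hBs, Fin.sum_univ_castSucc, hlast, zero_mul, add_zero]
  rfl

lemma qdet_succ (F : Polynomial ℚ) (i : ℕ) :
    qdet (m + 1) F i
      = ∑ c, Polynomial.aeval (X c) F * (X c ^ i * firstRowCofactor c) := by
  simp only [← mul_assoc]
  rw [← det_firstRowMatrix fun c => Polynomial.aeval (X c) F * X c ^ i]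
  rfl

lemma rename_aeval_X {ι : Type*} (σ : Equiv.Perm ι) (F : Polynomial ℚ) (c : ι) :
    rename σ (Polynomial.aeval (X c : MvPolynomial ι ℚ) F) = Polynomial.aeval (X (σ c)) F := by
  rw [← Polynomial.aeval_algHom_apply, rename_X]

lemma rename_qdet (n : ℕ) (F : Polynomial ℚ) (i : ℕ) (σ : Equiv.Perm (Fin n)) :
    rename σ (qdet n F i) = (Equiv.Perm.sign σ : ℤ) • qdet n F i := by
  refine rename_det_of_rename_apply fun r c => ?_
  by_cases hr : (r : ℕ) = 0 <;> simp [hr]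

end Cofactors

section Ideal

variable {m : ℕ} (F : Polynomial ℚ)

/-- The ideal generated by the differences `F(X (i + 1)) - F(X i)`. -/
noncomputable def diffIdeal (m : ℕ) : Ideal (MvPolynomial (Fin (m + 1)) ℚ) :=
  Ideal.span (Set.range fun i : Fin m =>
    Polynomial.aeval (X i.succ) F - Polynomial.aeval (X i.castSucc) F)

lemma aeval_sub_aeval_zero_mem_diffIdeal (c : Fin (m + 1)) :
    Polynomial.aeval (X c) F - Polynomial.aeval (X 0) F ∈ diffIdeal F m := by
  induction c using Fin.induction with
  | zero => simp
  | succ i ih =>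
    rw [← sub_add_sub_cancel _ (Polynomial.aeval (X i.castSucc) F)]
    exact add_mem (Ideal.subset_span ⟨i, rfl⟩) ih

lemma qdet_mem_diffIdeal {i : ℕ} (hi : i < m) : qdet (m + 1) F i ∈ diffIdeal F m := by
  have h : qdet (m + 1) F i = ∑ c : Fin (m + 1),
      (Polynomial.aeval (X c) F - Polynomial.aeval (X 0) F) * (X c ^ i * firstRowCofactor c) := by
    simp only [sub_mul, Finset.sum_sub_distrib, ← Finset.mul_sum]
    rw [sum_X_pow_mul_firstRowCofactor hi, mul_zero, sub_zero, qdet_succ]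
  rw [h]
  exact sum_mem fun c _ => Ideal.mul_mem_right _ _ (aeval_sub_aeval_zero_mem_diffIdeal F c)

lemma exists_eq_sum_of_mem_diffIdeal {p : MvPolynomial (Fin (m + 1)) ℚ}
    (hp : p ∈ diffIdeal F m) :
    ∃ a : Fin (m + 1) → MvPolynomial (Fin (m + 1)) ℚ,
      ∑ c, a c = 0 ∧ p = ∑ c, a c * Polynomial.aeval (X c) F := by
  induction hp using Submodule.span_induction with
  | mem x hx =>
    obtain ⟨i, rfl⟩ := hx
    refine ⟨Pi.single i.succ 1 - Pi.single i.castSucc 1, ?_, ?_⟩ <;>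
      simp [sub_mul, Pi.single_apply]
  | zero => exact ⟨0, by simp, by simp⟩
  | add x y _ _ hx hy =>
    obtain ⟨a, ha, rfl⟩ := hx
    obtain ⟨b, hb, rfl⟩ := hy
    exact ⟨a + b, by simp [Finset.sum_add_distrib, ha, hb],
      by simp [Finset.sum_add_distrib, add_mul]⟩
  | smul r x _ hx =>
    obtain ⟨a, ha, rfl⟩ := hx
    exact ⟨fun c => r * a c, by rw [← Finset.mul_sum, ha, mul_zero],
      by simp [Finset.mul_sum, mul_assoc]⟩

/-- The coefficients of an antisymmetric element of `diffIdeal F m` can be chosen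
equivariantly, after multiplication by `(m + 1)!`. -/
lemma exists_antisymmetric_eq_sum_of_mem_diffIdeal {p : MvPolynomial (Fin (m + 1)) ℚ}
    (hp : p ∈ diffIdeal F m)
    (hσ : ∀ σ : Equiv.Perm (Fin (m + 1)), rename σ p = (Equiv.Perm.sign σ : ℤ) • p) :
    ∃ B : Fin (m + 1) → MvPolynomial (Fin (m + 1)) ℚ,
      (∀ (σ : Equiv.Perm (Fin (m + 1))) c,
        rename σ (B c) = (Equiv.Perm.sign σ : ℤ) • B (σ c)) ∧
      ∑ c, B c = 0 ∧
      Fintype.card (Equiv.Perm (Fin (m + 1))) • p = ∑ c, B c * Polynomial.aeval (X c) F := by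
  obtain ⟨a, ha, hpa⟩ := exists_eq_sum_of_mem_diffIdeal F hp
  refine ⟨fun d => ∑ σ : Equiv.Perm (Fin (m + 1)),
    (Equiv.Perm.sign σ : ℤ) • rename σ (a (σ.symm d)), fun τ c => ?_, ?_, ?_⟩
  · rw [map_sum, Finset.smul_sum]
    refine Fintype.sum_equiv (Equiv.mulLeft τ) _ _ fun σ => ?_
    have hsq : (Equiv.Perm.sign τ : ℤ) * (Equiv.Perm.sign τ : ℤ) = 1 := by
      rw [← Units.val_mul, Int.units_mul_self, Units.val_one]
    have hsymm : (τ * σ).symm (τ c) = σ.symm c := by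
      rw [Equiv.symm_apply_eq, Equiv.Perm.mul_apply, Equiv.apply_symm_apply]
    simp only [Equiv.coe_mulLeft]
    rw [hsymm, map_mul, Units.val_mul, smul_smul, ← mul_assoc, hsq, one_mul,
      map_zsmul, rename_rename]
    rfl
  · rw [Finset.sum_comm]
    refine Finset.sum_eq_zero fun σ _ => ?_
    rw [← Finset.smul_sum, ← map_sum, Equiv.sum_comp σ.symm a, ha, map_zero, smul_zero]
  · simp only [Finset.sum_mul]
    rw [Finset.sum_comm, ← Finset.card_univ, ← Finset.sum_const]
    refine Finset.sum_congr rfl fun σ _ => ?_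
    have h : p = (Equiv.Perm.sign σ : ℤ) • rename σ p := by
      rw [hσ, smul_smul, ← Units.val_mul, Int.units_mul_self, Units.val_one, one_smul]
    rw [h, hpa, map_sum, Finset.smul_sum]
    refine Fintype.sum_equiv σ _ _ fun c => ?_
    rw [map_mul, rename_aeval_X, smul_mul_assoc, Equiv.symm_apply_apply]

end Ideal

/-- Let `n ≥ 2` and `F ∈ ℚ[t]` of degree ≥ 1.  In `P = ℚ[t₁,…,t_n]` let `J` be the ideal
generated by `F(t₂) − F(t₁), …, F(t_n) − F(t_{n−1})`.  Then the set of antisymmetric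
elements of `J` equals the submodule of `P` over the subring `P^{S_n}` of symmetric
polynomials generated by `q₀, …, q_{n−2}`. -/
theorem stmt9 (n : ℕ) (hn : 2 ≤ n) (F : Polynomial ℚ) (hF : 1 ≤ F.natDegree)
    (J : Ideal (MvPolynomial (Fin n) ℚ))
    (hJ : J = Ideal.span (Set.range fun i : Fin (n - 1) =>
      Polynomial.aeval (X (⟨(i : ℕ) + 1, by have := i.2; omega⟩ : Fin n)) F
        - Polynomial.aeval (X (⟨(i : ℕ), by have := i.2; omega⟩ : Fin n)) F)) :
    {p : MvPolynomial (Fin n) ℚ | p ∈ J ∧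
        ∀ σ : Equiv.Perm (Fin n), rename σ p = (Equiv.Perm.sign σ : ℤ) • p}
      = (Submodule.span (symmetricSubalgebra (Fin n) ℚ)
          (Set.range fun i : Fin (n - 1) => qdet n F (i : ℕ)) : Set _) := by
  obtain ⟨m, rfl⟩ : ∃ m, n = m + 1 := ⟨n - 1, by omega⟩
  replace hJ : J = diffIdeal F m := hJ
  subst hJ
  ext p
  simp only [Set.mem_ofPred_eq, SetLike.mem_coe]
  constructor
  · rintro ⟨hp, hσ⟩
    obtain ⟨B, hB, hsum, hpB⟩ := exists_antisymmetric_eq_sum_of_mem_diffIdeal F hp hσ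
    obtain ⟨s, hs, hBs⟩ := exists_isSymmetric_eq_sum_mul_firstRowCofactor hB hsum
    set N := Fintype.card (Equiv.Perm (Fin (m + 1)))
    have hN : (N : ℚ) ≠ 0 := Nat.cast_ne_zero.2 Fintype.card_ne_zero
    have hNp : N • p = ∑ i : Fin m, s i * qdet (m + 1) F i := by
      rw [hpB]
      simp only [hBs, qdet_succ, Finset.sum_mul, Finset.mul_sum]
      rw [Finset.sum_comm]
      exact Finset.sum_congr rfl fun i _ => Finset.sum_congr rfl fun c _ => by ring
    have hmem : N • p ∈ Submodule.span (symmetricSubalgebra (Fin (m + 1)) ℚ)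
        (Set.range fun i : Fin m => qdet (m + 1) F (i : ℕ)) := by
      rw [hNp]
      exact sum_mem fun i _ => Submodule.smul_mem _
        (⟨s i, hs i⟩ : symmetricSubalgebra (Fin (m + 1)) ℚ) (Submodule.subset_span ⟨i, rfl⟩)
    have hp' : p = (N : ℚ)⁻¹ • N • p := by
      rw [← Nat.cast_smul_eq_nsmul ℚ, inv_smul_smul₀ hN]
    rw [hp']
    exact Submodule.smul_of_tower_mem _ _ hmem
  · intro hp
    induction hp using Submodule.span_induction with
    | mem x hx =>
      obtain ⟨i, rfl⟩ := hx
      exact ⟨qdet_mem_diffIdeal F i.2, rename_qdet _ F _⟩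
    | zero => exact ⟨zero_mem _, by simp⟩
    | add x y _ _ hx hy =>
      exact ⟨add_mem hx.1 hy.1, fun σ => by rw [map_add, hx.2, hy.2, smul_add]⟩
    | smul r x _ hx =>
      rw [Subalgebra.smul_def, smul_eq_mul]
      refine ⟨Ideal.mul_mem_left _ _ hx.1, fun σ => ?_⟩
      rw [map_mul, hx.2, (mem_symmetricSubalgebra _).1 r.2 σ, mul_smul_comm]
end

section
/- Let n ≥ 2 and let F ∈ ℚ[t] be a polynomial of degree ≥ 1. Let R_ℚ = ℚ[t_1,…,t_n]/(t_1⋯t_n − 1), let u be the image of F(t_1)F(t_2)⋯F(t_n) in R_ℚ, and let R_{F,ℚ} be the localization of R_ℚ at the multiplicative set generated by u. The S_n-action on R_ℚ by permutation of the variables (well defined since t_1⋯t_n − 1 is invariant) extends to R_{F,ℚ} since u is S_n-invariant. Let I_{F,ℚ} be the ideal of R_{F,ℚ} generated by the images of F(t_2) − F(t_1), …, F(t_n) − F(t_{n−1}). Then the set of antisymmetric elements of I_{F,ℚ} equals the submodule of R_{F,ℚ} over the invariant subring (R_{F,ℚ})^{S_n} generated by the images of q_0, q_1, …, q_{n−2}.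 -/
set_option synthInstance.maxHeartbeats 1000000

open MvPolynomial

open Matrix in
/-- The determinant of a matrix with one row replaced, expanded along the new row. -/
theorem Matrix.det_updateRow_eq_sum_adjugate {ι R : Type*} [Fintype ι] [DecidableEq ι] [CommRing R]
    (A : Matrix ι ι R) (i : ι) (g : ι → R) :
    (A.updateRow i g).det = ∑ c, A.adjugate c i * g c := by
  rw [← cramer_transpose_apply, cramer_eq_adjugate_mulVec, ← adjugate_transpose]
  rfl

namespace AntisymmetricIdeal

variable {n : ℕ}

/-- The family of variables `(t₁, …, t_n)`. -/
noncomputable def vars (n : ℕ) : Fin n → MvPolynomial (Fin n) ℚ := X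

/-- The polynomial `∏ (T - t_i)`. -/
noncomputable def charPoly (n : ℕ) : Polynomial (MvPolynomial (Fin n) ℚ) :=
  ∏ i : Fin n, (Polynomial.X - Polynomial.C (X i))

theorem charPoly_monic (n : ℕ) : (charPoly n).Monic :=
  Polynomial.monic_prod_of_monic _ _ fun _ _ => Polynomial.monic_X_sub_C _

theorem charPoly_natDegree (n : ℕ) : (charPoly n).natDegree = n := by
  simp [charPoly]

theorem charPoly_map_rename (σ : Equiv.Perm (Fin n)) :
    (charPoly n).map (rename σ : MvPolynomial (Fin n) ℚ →ₐ[ℚ] _).toRingHom = charPoly n := by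
  simp only [charPoly, Polynomial.map_prod]
  conv_rhs => rw [← Equiv.prod_comp σ]
  simp

theorem charPoly_coeff_isSymmetric (k : ℕ) : ((charPoly n).coeff k).IsSymmetric := fun σ => by
  conv_rhs => rw [← charPoly_map_rename σ, Polynomial.coeff_map]
  rfl

/-- The families `(h(t₁), …, h(t_n))` with `h` a polynomial over the symmetric polynomials. -/
noncomputable def families (n : ℕ) :
    Subalgebra (symmetricSubalgebra (Fin n) ℚ) (Fin n → MvPolynomial (Fin n) ℚ) :=
  Algebra.adjoin _ {vars n}

theorem vars_mem_families : vars n ∈ families n :=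
  Algebra.subset_adjoin rfl

theorem exists_monic_aeval_vars_eq_zero (n : ℕ) :
    ∃ f : Polynomial (symmetricSubalgebra (Fin n) ℚ),
      f.Monic ∧ f.natDegree = n ∧ Polynomial.aeval (vars n) f = 0 := by
  obtain ⟨f, hf, hdeg, hmon⟩ := Polynomial.lifts_and_natDegree_eq_and_monic
    (f := algebraMap (symmetricSubalgebra (Fin n) ℚ) (MvPolynomial (Fin n) ℚ))
    ((Polynomial.lifts_iff_coeff_lifts _).2 fun k =>
      ⟨⟨(charPoly n).coeff k, charPoly_coeff_isSymmetric k⟩, rfl⟩) (charPoly_monic n)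
  refine ⟨f, hmon, hdeg.trans (charPoly_natDegree n), ?_⟩
  funext c
  have h : Polynomial.aeval (vars n) f c = Polynomial.aeval (vars n c) f :=
    (Polynomial.aeval_algHom_apply (Pi.evalAlgHom (symmetricSubalgebra (Fin n) ℚ)
      (fun _ : Fin n => MvPolynomial (Fin n) ℚ) c) (vars n) f).symm
  rw [h, ← Polynomial.eval_map_algebraMap, hf]
  change (charPoly n).eval (X c) = 0
  rw [charPoly, Polynomial.eval_prod]
  exact Finset.prod_eq_zero (Finset.mem_univ c) (by simp)

/-- The matrix with rows `(t_c ^ (n - 1 - r))_c`. -/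
noncomputable def powMatrix (n : ℕ) : Matrix (Fin n) (Fin n) (MvPolynomial (Fin n) ℚ) :=
  Matrix.of fun r c => X c ^ (n - 1 - (r : ℕ))

theorem exists_coeff_of_mem_families {f : Fin n → MvPolynomial (Fin n) ℚ} (hf : f ∈ families n) :
    ∃ s : Fin n → symmetricSubalgebra (Fin n) ℚ,
      f = ∑ k, (s k : MvPolynomial (Fin n) ℚ) • powMatrix n k := by
  obtain ⟨p, hmon, hdeg, hp⟩ := exists_monic_aeval_vars_eq_zero n
  have h := Submodule.span_range_natDegree_eq_adjoin hmon hp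
  rw [hdeg] at h
  have hf' : f ∈ Submodule.span (symmetricSubalgebra (Fin n) ℚ) (Set.range (powMatrix n)) := by
    have : f ∈ Subalgebra.toSubmodule (families n) := hf
    rw [families, ← h] at this
    refine Submodule.span_mono ?_ this
    intro g hg
    simp only [Finset.coe_image, Finset.coe_range, Set.mem_image, Set.mem_Iio] at hg
    obtain ⟨k, hk, rfl⟩ := hg
    refine ⟨⟨n - 1 - k, by omega⟩, ?_⟩
    funext c
    simp [powMatrix, vars, show n - 1 - (n - 1 - k) = k by omega]
  obtain ⟨s, hs⟩ := (Submodule.mem_span_range_iff_exists_fun _).1 hf'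
  exact ⟨s, hs.symm⟩

theorem det_powMatrix_ne_zero (n : ℕ) : (powMatrix n).det ≠ 0 := by
  have h : powMatrix n = (Matrix.vandermonde (vars n)).transpose.submatrix Fin.revPerm id := by
    ext1 r c
    simp only [powMatrix, vars, Matrix.of_apply, Matrix.submatrix_apply, Matrix.transpose_apply,
      Matrix.vandermonde_apply, Fin.revPerm_apply, Fin.val_rev, id]
    congr 1
    omega
  rw [h, Matrix.det_permute, Matrix.det_transpose]
  refine mul_ne_zero ?_ (Matrix.det_vandermonde_ne_zero_iff.2 (X_injective))
  rcases Int.units_eq_one_or (Equiv.Perm.sign (Fin.revPerm : Equiv.Perm (Fin n))) with h | h <;>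
    simp [h]

/-- The coefficients of `∏_{e ≠ c} (T - t_e)`, in decreasing order. -/
noncomputable def cofactorCoeff (n : ℕ) (k c : Fin n) : MvPolynomial (Fin n) ℚ :=
  (charPoly n /ₘ (Polynomial.X - Polynomial.C (X c))).coeff (n - 1 - k)

theorem cofactorCoeff_mem_families (k : Fin n) : cofactorCoeff n k ∈ families n := by
  have h : cofactorCoeff n k = ∑ i ∈ Finset.Icc (n - 1 - (k : ℕ) + 1) n,
      (⟨(charPoly n).coeff i, charPoly_coeff_isSymmetric i⟩ : symmetricSubalgebra (Fin n) ℚ) •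
        vars n ^ (i - (n - 1 - (k : ℕ) + 1)) := by
    funext c
    simp only [cofactorCoeff, Polynomial.coeff_divByMonic_X_sub_C, charPoly_natDegree,
      Finset.sum_apply, Pi.smul_apply, Pi.pow_apply, Subalgebra.smul_def, smul_eq_mul, vars]
    exact Finset.sum_congr rfl fun i _ => mul_comm _ _
  rw [h]
  exact sum_mem fun i _ => Subalgebra.smul_mem _ (pow_mem vars_mem_families _) _

theorem charPoly_divByMonic (c : Fin n) :
    charPoly n /ₘ (Polynomial.X - Polynomial.C (X c)) =
      ∏ e ∈ Finset.univ.erase c, (Polynomial.X - Polynomial.C (X e)) := by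
  rw [charPoly, ← Finset.mul_prod_erase _ _ (Finset.mem_univ c)]
  exact Polynomial.mul_divByMonic_cancel_left _ (Polynomial.monic_X_sub_C _)

theorem sum_cofactorCoeff_mul_powMatrix (c d : Fin n) :
    ∑ k, cofactorCoeff n k c * powMatrix n k d = ∏ e ∈ Finset.univ.erase c, (X d - X e) := by
  have hn : 0 < n := c.pos
  have hdeg : (charPoly n /ₘ (Polynomial.X - Polynomial.C (X c))).natDegree < n := by
    rw [Polynomial.natDegree_divByMonic _ (Polynomial.monic_X_sub_C _), charPoly_natDegree,
      Polynomial.natDegree_X_sub_C]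
    omega
  have h := Polynomial.eval_eq_sum_range' hdeg (X d)
  rw [← Finset.sum_range_reflect, ← Fin.sum_univ_eq_sum_range (fun j =>
    (charPoly n /ₘ (Polynomial.X - Polynomial.C (X c))).coeff (n - 1 - j) * X d ^ (n - 1 - j)) n] at h
  refine h.symm.trans ?_
  rw [charPoly_divByMonic, Polynomial.eval_prod]
  simp

theorem cofactorCoeff_zero [NeZero n] (c : Fin n) : cofactorCoeff n 0 c = 1 := by
  have h : (charPoly n /ₘ (Polynomial.X - Polynomial.C (X c))).Monic := by
    rw [charPoly_divByMonic]
    exact Polynomial.monic_prod_of_monic _ _ fun _ _ => Polynomial.monic_X_sub_C _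
  have hdeg : (charPoly n /ₘ (Polynomial.X - Polynomial.C (X c))).natDegree = n - 1 := by
    rw [Polynomial.natDegree_divByMonic _ (Polynomial.monic_X_sub_C _), charPoly_natDegree,
      Polynomial.natDegree_X_sub_C]
  rw [cofactorCoeff, Fin.val_zero, Nat.sub_zero, ← hdeg]
  exact h

theorem adjugate_powMatrix [NeZero n] (c k : Fin n) :
    (powMatrix n).adjugate c k = (powMatrix n).adjugate c 0 * cofactorCoeff n k c := by
  have hdiag : (Matrix.of fun c k => cofactorCoeff n k c) * powMatrix n =
      Matrix.diagonal fun c => ∏ e ∈ Finset.univ.erase c, (X c - X e) := by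
    ext1 c d
    rw [Matrix.mul_apply, Matrix.diagonal_apply]
    refine (sum_cofactorCoeff_mul_powMatrix c d).trans ?_
    split_ifs with h
    · rw [h]
    · exact Finset.prod_eq_zero (Finset.mem_erase.2 ⟨Ne.symm h, Finset.mem_univ d⟩) (sub_self _)
  have hmul (k : Fin n) : cofactorCoeff n k c * (powMatrix n).det =
      (∏ e ∈ Finset.univ.erase c, (X c - X e)) * (powMatrix n).adjugate c k := by
    have h := congrArg (fun M => (M * (powMatrix n).adjugate) c k) hdiag
    simp only [Matrix.mul_assoc, Matrix.mul_adjugate, Matrix.mul_smul, Matrix.mul_one,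
      Matrix.smul_apply, Matrix.of_apply, Matrix.diagonal_mul, smul_eq_mul] at h
    rw [← h, mul_comm]
  have h0 := hmul 0
  rw [cofactorCoeff_zero, one_mul] at h0
  have hne : (∏ e ∈ Finset.univ.erase c, (X c - X e : MvPolynomial (Fin n) ℚ)) ≠ 0 := by
    refine Finset.prod_ne_zero_iff.2 fun e he => sub_ne_zero.2 fun h => ?_
    exact (Finset.mem_erase.1 he).1 (X_injective h).symm
  refine mul_left_cancel₀ hne ?_
  rw [← hmul, h0]
  ring

/-- The determinant with rows `g, t^(n-2), …, t, 1`, as a function of `g`. -/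
noncomputable def rowDet (n : ℕ) [NeZero n] :
    (Fin n → MvPolynomial (Fin n) ℚ) →ₗ[MvPolynomial (Fin n) ℚ] MvPolynomial (Fin n) ℚ where
  toFun g := ((powMatrix n).updateRow 0 g).det
  map_add' := Matrix.det_updateRow_add _ _
  map_smul' := Matrix.det_updateRow_smul _ _

theorem rowDet_apply [NeZero n] (g : Fin n → MvPolynomial (Fin n) ℚ) :
    rowDet n g = ((powMatrix n).updateRow 0 g).det := rfl

/-- The functional `g ↦ det (…, g, …)` is `rowDet` precomposed with a multiplication. -/
theorem exists_pairing [NeZero n] (f : Fin n → Fin n → MvPolynomial (Fin n) ℚ)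
    (hf : ∀ r, f r ∈ families n) (i : Fin n) :
    ∃ h ∈ families n, ∀ g, (Matrix.updateRow (Matrix.of f) i g).det =
      rowDet n (g * h) := by
  choose s hs using fun r => exists_coeff_of_mem_families (hf r)
  have hmul : Matrix.of f =
      (Matrix.of s).map (algebraMap _ (MvPolynomial (Fin n) ℚ)) * powMatrix n := by
    ext1 r c
    rw [Matrix.mul_apply, Matrix.of_apply, hs]
    simp [Finset.sum_apply]
  refine ⟨∑ k, (Matrix.of s).adjugate k i • cofactorCoeff n k,
    sum_mem fun k _ => Subalgebra.smul_mem _ (cofactorCoeff_mem_families k) _, fun g => ?_⟩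
  rw [rowDet_apply, Matrix.det_updateRow_eq_sum_adjugate, Matrix.det_updateRow_eq_sum_adjugate, hmul,
    Matrix.adjugate_mul_distrib]
  refine Finset.sum_congr rfl fun c _ => ?_
  have hadj (k : Fin n) : ((Matrix.of s).map (algebraMap _ (MvPolynomial (Fin n) ℚ))).adjugate k i =
      ((Matrix.of s).adjugate k i : MvPolynomial (Fin n) ℚ) := by
    have := RingHom.map_adjugate (algebraMap (symmetricSubalgebra (Fin n) ℚ)
      (MvPolynomial (Fin n) ℚ)) (Matrix.of s)
    exact (congrFun (congrFun this k) i).symm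
  simp only [Matrix.mul_apply, Pi.mul_apply, Finset.sum_apply, Pi.smul_apply, Subalgebra.smul_def,
    smul_eq_mul, hadj, Finset.mul_sum, Finset.sum_mul]
  refine Finset.sum_congr rfl fun k _ => ?_
  rw [adjugate_powMatrix c k]
  ring

theorem rowDet_powMatrix [NeZero n] (k : Fin n) :
    rowDet n (powMatrix n k) = if k = 0 then (powMatrix n).det else 0 := by
  rw [rowDet_apply]
  split_ifs with h
  · rw [h, Matrix.updateRow_eq_self]
  · exact Matrix.det_updateRow_eq_zero h

theorem qdet_eq_rowDet [NeZero n] (F : Polynomial ℚ) (k : ℕ) :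
    qdet n F k = rowDet n fun c => Polynomial.aeval (X c) F * X c ^ k := by
  rw [qdet, rowDet_apply]
  congr 1
  ext1 r c
  simp only [Matrix.of_apply, Matrix.updateRow_apply, Fin.val_eq_zero_iff, powMatrix]

/-- The span of `q₀, …, q_{n-2}` over the symmetric polynomials. -/
noncomputable def qSpan (n : ℕ) (F : Polynomial ℚ) :
    Submodule (symmetricSubalgebra (Fin n) ℚ) (MvPolynomial (Fin n) ℚ) :=
  Submodule.span _ (Set.range fun i : Fin (n - 1) => qdet n F i)

theorem rowDet_mul_mem_qSpan [NeZero n] (F : Polynomial ℚ) {f : Fin n → MvPolynomial (Fin n) ℚ}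
    (hf : f ∈ families n) (h0 : rowDet n f = 0) :
    rowDet n ((fun c => Polynomial.aeval (X c) F) * f) ∈ qSpan n F := by
  obtain ⟨s, rfl⟩ := exists_coeff_of_mem_families hf
  have hs : (s 0 : MvPolynomial (Fin n) ℚ) = 0 := by
    simpa [map_sum, rowDet_powMatrix, det_powMatrix_ne_zero] using h0
  rw [Finset.mul_sum, map_sum]
  refine sum_mem fun k _ => ?_
  rw [mul_smul_comm, map_smul]
  rcases eq_or_ne k 0 with rfl | hk
  · rw [hs, zero_smul]
    exact zero_mem _
  · refine Submodule.smul_mem _ (s k) (Submodule.subset_span ⟨⟨n - 1 - k, ?_⟩, ?_⟩)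
    · have := Fin.pos_iff_ne_zero.2 hk
      have : 0 < (k : ℕ) := this
      omega
    · exact qdet_eq_rowDet F _

theorem det_updateRow_sub_mem_qSpan [NeZero n] (F : Polynomial ℚ)
    (f : Fin n → Fin n → MvPolynomial (Fin n) ℚ) (hf : ∀ r, f r ∈ families n) (i j : Fin n) :
    ((Matrix.of f).updateRow j ((fun c => Polynomial.aeval (X c) F) * f j)).det -
      ((Matrix.of f).updateRow i ((fun c => Polynomial.aeval (X c) F) * f i)).det ∈ qSpan n F := by
  obtain ⟨h₁, hh₁, hd₁⟩ := exists_pairing f hf i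
  obtain ⟨h₂, hh₂, hd₂⟩ := exists_pairing f hf j
  rw [hd₁, hd₂, ← map_sub, mul_assoc, mul_assoc, ← mul_sub]
  refine rowDet_mul_mem_qSpan F (sub_mem (mul_mem (hf j) hh₂) (mul_mem (hf i) hh₁)) ?_
  have hself (r : Fin n) : (Matrix.of f).updateRow r (f r) = Matrix.of f :=
    Matrix.updateRow_eq_self _ r
  rw [map_sub, ← hd₁, ← hd₂, hself, hself, sub_self]

/-- The antisymmetrization `∑ σ, sign σ • σ p`. -/
noncomputable def alternation (n : ℕ) : MvPolynomial (Fin n) ℚ →ₗ[ℚ] MvPolynomial (Fin n) ℚ :=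
  ∑ σ : Equiv.Perm (Fin n), (Equiv.Perm.sign σ : ℤ) • (rename σ).toLinearMap

theorem alternation_apply (p : MvPolynomial (Fin n) ℚ) :
    alternation n p = ∑ σ : Equiv.Perm (Fin n), (Equiv.Perm.sign σ : ℤ) • rename σ p := by
  simp [alternation]

theorem alternation_prod (f : Fin n → Polynomial ℚ) :
    alternation n (∏ r, Polynomial.aeval (X r) (f r)) =
      (Matrix.of fun r c : Fin n => Polynomial.aeval (X c : MvPolynomial (Fin n) ℚ) (f r)).det := by
  rw [alternation_apply, ← Matrix.det_transpose, Matrix.det_apply]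
  refine Finset.sum_congr rfl fun σ _ => ?_
  rw [map_prod, Units.smul_def]
  congr 1
  refine Finset.prod_congr rfl fun r _ => ?_
  rw [← Polynomial.aeval_algHom_apply, rename_X]
  rfl

theorem alternation_monomial_mul (F : Polynomial ℚ) (α : Fin n →₀ ℕ) (i : Fin n) :
    alternation n (monomial α 1 * Polynomial.aeval (X i) F) =
      ((Matrix.of fun r => vars n ^ α r).updateRow i
        ((fun c => Polynomial.aeval (X c) F) * vars n ^ α i)).det := by
  have h : monomial α 1 * Polynomial.aeval (X i) F =
      ∏ r, Polynomial.aeval (X r : MvPolynomial (Fin n) ℚ)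
        (if r = i then F * Polynomial.X ^ α r else Polynomial.X ^ α r) := by
    have hr (r : Fin n) : Polynomial.aeval (X r : MvPolynomial (Fin n) ℚ)
        (if r = i then F * Polynomial.X ^ α r else Polynomial.X ^ α r) =
        X r ^ α r * if r = i then Polynomial.aeval (X r) F else 1 := by
      split_ifs <;> simp [mul_comm]
    simp only [hr, Finset.prod_mul_distrib, Finset.prod_ite_eq', Finset.mem_univ, if_true]
    rw [monomial_eq, C_1, one_mul, Finsupp.prod_fintype _ _ fun _ => pow_zero _]
  rw [h, alternation_prod]
  congr 1
  ext1 r c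
  rw [Matrix.updateRow_apply, Matrix.of_apply]
  split_ifs with hri
  · simp [hri, vars]
  · simp [vars]

theorem alternation_mul_sub_mem_qSpan [NeZero n] (F : Polynomial ℚ) (p : MvPolynomial (Fin n) ℚ)
    (i j : Fin n) :
    alternation n (p * (Polynomial.aeval (X j) F - Polynomial.aeval (X i) F)) ∈ qSpan n F := by
  induction p using MvPolynomial.induction_on' with
  | monomial α a =>
    have h : monomial α a * (Polynomial.aeval (X j) F - Polynomial.aeval (X i) F) =
        a • (monomial α 1 * Polynomial.aeval (X j) F - monomial α 1 * Polynomial.aeval (X i) F) := by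
      rw [← mul_sub, ← smul_mul_assoc, smul_monomial, smul_eq_mul, mul_one]
    rw [h, map_smul, map_sub, alternation_monomial_mul, alternation_monomial_mul]
    exact Submodule.smul_of_tower_mem _ a (det_updateRow_sub_mem_qSpan F _
      (fun r => pow_mem vars_mem_families _) i j)
  | add p q hp hq =>
    rw [add_mul, map_add]
    exact add_mem hp hq

/-- The ideal generated by the `F(t_{i+1}) - F(t_i)`. -/
noncomputable def diffIdeal (n : ℕ) (F : Polynomial ℚ) : Ideal (MvPolynomial (Fin n) ℚ) :=
  Ideal.span (Set.range fun i : Fin (n - 1) =>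
    Polynomial.aeval (X (⟨(i : ℕ) + 1, by have := i.2; omega⟩ : Fin n)) F -
      Polynomial.aeval (X (⟨(i : ℕ), by have := i.2; omega⟩ : Fin n)) F)

theorem alternation_mem_qSpan [NeZero n] {F : Polynomial ℚ} {p : MvPolynomial (Fin n) ℚ}
    (hp : p ∈ diffIdeal n F) : alternation n p ∈ qSpan n F := by
  obtain ⟨a, rfl⟩ := (Submodule.mem_span_range_iff_exists_fun _).1 hp
  rw [map_sum]
  exact sum_mem fun i _ => alternation_mul_sub_mem_qSpan F _ _ _

theorem aeval_sub_aeval_zero_mem_diffIdeal [NeZero n] (F : Polynomial ℚ) (c : Fin n) :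
    Polynomial.aeval (X c) F - Polynomial.aeval (X 0) F ∈ diffIdeal n F := by
  obtain ⟨c, hc⟩ := c
  induction c with
  | zero =>
    have h : (⟨0, hc⟩ : Fin n) = 0 := rfl
    rw [h, sub_self]
    exact zero_mem _
  | succ c ih =>
    rw [← sub_add_sub_cancel _ (Polynomial.aeval (X ⟨c, by omega⟩) F) _]
    exact add_mem (Ideal.subset_span ⟨⟨c, by omega⟩, rfl⟩) (ih _)

theorem qdet_mem_diffIdeal (F : Polynomial ℚ) {k : ℕ} (hk : k < n - 1) :
    qdet n F k ∈ diffIdeal n F := by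
  have : NeZero n := ⟨by omega⟩
  have h0 : rowDet n (fun c => X c ^ k) = 0 := by
    have h := rowDet_powMatrix (n := n) ⟨n - 1 - k, by omega⟩
    rw [if_neg (Fin.ne_of_val_ne (by simp; omega))] at h
    rw [← h]
    congr 1
    funext c
    simp [powMatrix, show n - 1 - (n - 1 - k) = k by omega]
  have h : qdet n F k = rowDet n fun c =>
      (Polynomial.aeval (X c) F - Polynomial.aeval (X 0) F) * X c ^ k := by
    have hsub : (fun c : Fin n => (Polynomial.aeval (X c : MvPolynomial (Fin n) ℚ) F -
        Polynomial.aeval (X 0) F) * X c ^ k) =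
        (fun c => Polynomial.aeval (X c) F * X c ^ k) -
          (Polynomial.aeval (X 0) F : MvPolynomial (Fin n) ℚ) • fun c => X c ^ k := by
      funext c
      simp [sub_mul]
    rw [hsub, map_sub, map_smul, h0, smul_zero, sub_zero, qdet_eq_rowDet]
  rw [h, rowDet_apply, Matrix.det_updateRow_eq_sum_adjugate]
  exact sum_mem fun c _ => Ideal.mul_mem_left _ _
    (Ideal.mul_mem_right _ _ (aeval_sub_aeval_zero_mem_diffIdeal F c))

theorem rename_qdet (F : Polynomial ℚ) (k : ℕ) (σ : Equiv.Perm (Fin n)) :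
    rename σ (qdet n F k) = (Equiv.Perm.sign σ : ℤ) • qdet n F k := by
  rw [qdet, AlgHom.map_det, zsmul_eq_mul, ← Matrix.det_permute']
  congr 1
  ext1 r c
  simp only [AlgHom.mapMatrix_apply, Matrix.map_apply, Matrix.of_apply, Matrix.submatrix_apply, id]
  split_ifs
  · rw [map_mul, map_pow, ← Polynomial.aeval_algHom_apply, rename_X]
  · rw [map_pow, rename_X]

end AntisymmetricIdeal

/-- Let `n ≥ 2`, `F ∈ ℚ[t]` of degree ≥ 1, `R_ℚ = ℚ[t₁,…,t_n]/(t₁⋯t_n − 1)`, `u` the image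
of `F(t₁)⋯F(t_n)`, and `R_{F,ℚ}` the localization at the powers of `u`, carrying the
`S_n`-action `act` characterized by `act σ (π p) = π (σ∗p)` on images `π p` of polynomials.
With `I_{F,ℚ}` the ideal generated by the images of `F(t₂) − F(t₁), …, F(t_n) − F(t_{n−1})`,
the antisymmetric elements of `I_{F,ℚ}` are exactly the `(R_{F,ℚ})^{S_n}`-linear
combinations of the images of `q₀, …, q_{n−2}`. -/
theorem stmt10 (n : ℕ) (hn : 2 ≤ n) (F : Polynomial ℚ) (hF : 1 ≤ F.natDegree)
    (I : Ideal (MvPolynomial (Fin n) ℚ))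
    (hI : I = Ideal.span {(∏ i : Fin n, X i) - 1})
    (u : MvPolynomial (Fin n) ℚ ⧸ I)
    (hu : u = Ideal.Quotient.mk I (∏ i : Fin n, Polynomial.aeval (X i) F))
    (act : Equiv.Perm (Fin n) →
      Localization (Submonoid.powers u) →+* Localization (Submonoid.powers u))
    (hact : ∀ (σ : Equiv.Perm (Fin n)) (p : MvPolynomial (Fin n) ℚ),
      act σ (algebraMap (MvPolynomial (Fin n) ℚ ⧸ I) (Localization (Submonoid.powers u))
          (Ideal.Quotient.mk I p))
        = algebraMap (MvPolynomial (Fin n) ℚ ⧸ I) (Localization (Submonoid.powers u))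
            (Ideal.Quotient.mk I (rename σ p)))
    (IF : Ideal (Localization (Submonoid.powers u)))
    (hIF : IF = Ideal.span (Set.range fun i : Fin (n - 1) =>
      algebraMap (MvPolynomial (Fin n) ℚ ⧸ I) (Localization (Submonoid.powers u))
        (Ideal.Quotient.mk I
          (Polynomial.aeval (X (⟨(i : ℕ) + 1, by have := i.2; omega⟩ : Fin n)) F
            - Polynomial.aeval (X (⟨(i : ℕ), by have := i.2; omega⟩ : Fin n)) F)))) :
    ∀ x : Localization (Submonoid.powers u),
      (x ∈ IF ∧ ∀ σ : Equiv.Perm (Fin n), act σ x = (Equiv.Perm.sign σ : ℤ) • x)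
        ↔ ∃ c : Fin (n - 1) → Localization (Submonoid.powers u),
            (∀ (i : Fin (n - 1)) (σ : Equiv.Perm (Fin n)), act σ (c i) = c i) ∧
            x = ∑ i : Fin (n - 1), c i *
              algebraMap (MvPolynomial (Fin n) ℚ ⧸ I) (Localization (Submonoid.powers u))
                (Ideal.Quotient.mk I (qdet n F (i : ℕ))) := by
  intro x
  have : NeZero n := ⟨by omega⟩
  set π : MvPolynomial (Fin n) ℚ →+* Localization (Submonoid.powers u) :=
    (algebraMap (MvPolynomial (Fin n) ℚ ⧸ I) (Localization (Submonoid.powers u))).comp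
      (Ideal.Quotient.mk I) with hπ
  have hact' (σ : Equiv.Perm (Fin n)) (p : MvPolynomial (Fin n) ℚ) :
      act σ (π p) = π (rename σ p) := hact σ p
  have hIF' : IF = (AntisymmetricIdeal.diffIdeal n F).map π := by
    rw [hIF, AntisymmetricIdeal.diffIdeal, Ideal.map_span, ← Set.range_comp]
    rfl
  constructor
  · rintro ⟨hx, hsign⟩
    obtain ⟨w, p, hp, hw, hxp⟩ : ∃ w, ∃ p ∈ AntisymmetricIdeal.diffIdeal n F,
        (∀ σ, act σ w = w) ∧ x = w * π p := by
      rw [hIF', hπ, ← Ideal.map_map,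
        IsLocalization.mem_map_algebraMap_iff (Submonoid.powers u)] at hx
      obtain ⟨⟨⟨y, hy⟩, ⟨_, k, rfl⟩⟩, hxy⟩ := hx
      obtain ⟨p, hp, rfl⟩ :=
        (Ideal.mem_map_iff_of_surjective _ Ideal.Quotient.mk_surjective).1 hy
      have hinv (σ : Equiv.Perm (Fin n)) : act σ (algebraMap _ _ (u ^ k)) =
          algebraMap _ (Localization (Submonoid.powers u)) (u ^ k) := by
        rw [map_pow, map_pow]
        congr 1
        have hU : algebraMap _ (Localization (Submonoid.powers u)) u =
            π (∏ i : Fin n, Polynomial.aeval (X i) F) :=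
          congrArg (algebraMap _ (Localization (Submonoid.powers u))) hu
        rw [hU, hact', map_prod, ← Equiv.prod_comp σ (fun i => Polynomial.aeval (X i) F)]
        congr 1
        refine Finset.prod_congr rfl fun i _ => ?_
        rw [← Polynomial.aeval_algHom_apply, rename_X]
      obtain ⟨w, hw⟩ := (IsLocalization.map_units (Localization (Submonoid.powers u))
        (⟨u ^ k, k, rfl⟩ : Submonoid.powers u)).exists_right_inv
      refine ⟨w, p, hp, fun σ => ?_, ?_⟩
      · have h := congrArg (act σ) hw
        rw [map_mul, map_one, hinv, mul_comm] at h
        exact left_inv_eq_right_inv h hw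
      · calc x = w * (x * algebraMap _ _ (u ^ k)) := by rw [mul_left_comm, mul_comm w, hw, mul_one]
          _ = w * π p := congrArg (w * ·) hxy
    obtain ⟨s, hs⟩ := (Submodule.mem_span_range_iff_exists_fun _).1
      (AntisymmetricIdeal.alternation_mem_qSpan hp)
    have hsum : (n.factorial : Localization (Submonoid.powers u)) * x =
        w * π (AntisymmetricIdeal.alternation n p) := by
      have h (σ : Equiv.Perm (Fin n)) :
          w * π ((Equiv.Perm.sign σ : ℤ) • rename σ p) = x := by
        rw [map_zsmul, mul_smul_comm, ← hact', ← hw σ, ← map_mul, ← hxp, hsign, smul_smul,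
          ← Units.val_mul, Int.units_mul_self, Units.val_one, one_smul]
      rw [AntisymmetricIdeal.alternation_apply, map_sum, Finset.mul_sum,
        Finset.sum_congr rfl fun σ _ => h σ]
      simp [Fintype.card_perm]
    have hfac : π (C (n.factorial : ℚ)⁻¹) * (n.factorial : Localization (Submonoid.powers u)) = 1 := by
      rw [← map_natCast π, ← map_mul, ← map_natCast C, ← map_mul,
        inv_mul_cancel₀ (Nat.cast_ne_zero.2 n.factorial_ne_zero), map_one, map_one]
    refine ⟨fun i => π (C (n.factorial : ℚ)⁻¹) * w * π (s i), fun i σ => ?_, ?_⟩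
    · rw [map_mul, map_mul, hact', hw, hact', rename_C,
        (mem_symmetricSubalgebra _).1 (s i).2 σ]
    · rw [← one_mul x, ← hfac, mul_assoc, hsum, ← hs, map_sum, Finset.mul_sum, Finset.mul_sum]
      refine Finset.sum_congr rfl fun i _ => ?_
      change _ = _ * π (qdet n F i)
      rw [Subalgebra.smul_def, smul_eq_mul, map_mul]
      ring
  · rintro ⟨c, hc, rfl⟩
    constructor
    · rw [hIF']
      exact sum_mem fun i _ => Ideal.mul_mem_left _ _
        (Ideal.mem_map_of_mem π (AntisymmetricIdeal.qdet_mem_diffIdeal F i.2))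
    · intro σ
      rw [map_sum, zsmul_eq_mul, Finset.mul_sum]
      refine Finset.sum_congr rfl fun i _ => ?_
      change act σ (c i * π _) = _ * (c i * π _)
      rw [map_mul, hc, hact', AntisymmetricIdeal.rename_qdet, map_zsmul, zsmul_eq_mul,
        mul_left_comm]
end
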